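/- arXiv:2604.04763 — 9 statements merged into one kernel-verified Lean document; each statement's English description precedes it below -/
import Mathlib

section
/- Let S be a semigroup such that every element of S is potentially invertible, i.e., for every a ∈ S there exist a monoid M and an injective multiplication-preserving map f : S → M such that f(a) is a unit of M. Then S is embeddable into a group: there exist a group G and an injective multiplication-preserving map from S into G. -/
/-- In a monoid, if `x * y * x` is a unit then both `x` and `y` are units. -/
theorem isUnit_and_isUnit_of_isUnit_mul_mul_self {M : Type*} [Monoid M] {x y : M}
    (h : IsUnit (x * y * x)) : IsUnit x ∧ IsUnit y := by
  have hx : IsUnit x := by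
    obtain ⟨b, hb, hb'⟩ := isUnit_iff_exists.1 h
    refine isUnit_iff_exists_and_exists.2 ⟨⟨y * x * b, ?_⟩, ⟨b * x * y, ?_⟩⟩
    · simpa only [mul_assoc] using hb
    · simpa only [mul_assoc] using hb'
  exact ⟨hx, hx.mul_left_iff.1 (hx.mul_right_iff.1 h)⟩

/-- In a nonempty semigroup, every finite set `F` admits an element `p` such that all elements
of `F` become invertible in any monoid in which `p` does. -/
theorem exists_forall_isUnit_of_isUnit {S : Type*} [Semigroup S] [Nonempty S] (F : Finset S) :
    ∃ p : S, ∀ (M : Type*) [Monoid M] (f : S → M), (∀ x y, f (x * y) = f x * f y) →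
      IsUnit (f p) → ∀ s ∈ F, IsUnit (f s) := by
  classical
  induction F using Finset.induction_on with
  | empty => exact ⟨Classical.arbitrary S, by simp⟩
  | insert a F _ ih =>
    obtain ⟨p, hp⟩ := ih
    refine ⟨p * a * p, fun M _ f hf hu => ?_⟩
    rw [hf, hf] at hu
    obtain ⟨hup, hua⟩ := isUnit_and_isUnit_of_isUnit_mul_mul_self hu
    simpa using ⟨hua, hp M f hf hup⟩

/-- The congruence on a product of monoids identifying functions that agree eventually along
a filter. -/
def Con.eventuallyEq {ι : Type*} (l : Filter ι) (M : ι → Type*) [∀ i, Monoid (M i)] :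
    Con (∀ i, M i) where
  r x y := ∀ᶠ i in l, x i = y i
  iseqv :=
    ⟨fun _ => .of_forall fun _ => rfl, fun h => h.mono fun _ hi => hi.symm,
      fun h h' => by filter_upwards [h, h'] with i hi hi' using hi.trans hi'⟩
  mul' h h' := by filter_upwards [h, h'] with i hi hi' using congrArg₂ (· * ·) hi hi'

theorem Con.isUnit_eventuallyEq_mk {ι : Type*} {l : Filter ι} {M : ι → Type*}
    [∀ i, Monoid (M i)] {x : ∀ i, M i} (h : ∀ᶠ i in l, IsUnit (x i)) :
    IsUnit (x : (Con.eventuallyEq l M).Quotient) := by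
  classical
  let y : ∀ i, M i := fun i => if hi : IsUnit (x i) then ↑hi.unit⁻¹ else 1
  refine isUnit_iff_exists.2 ⟨(y : (Con.eventuallyEq l M).Quotient), ?_, ?_⟩
  · refine (Con.eq (Con.eventuallyEq l M) (a := x * y) (b := 1)).2 ?_
    exact h.mono fun i hi => by simp [y, hi]
  · refine (Con.eq (Con.eventuallyEq l M) (a := y * x) (b := 1)).2 ?_
    exact h.mono fun i hi => by simp [y, hi]

/-- A semigroup all of whose elements are potentially invertible embeds into the unit group of
a reduced product of monoids. -/
theorem exists_group_embedding_of_potentially_invertible.{u, v} {S : Type u} [Semigroup S]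
    [Nonempty S]
    (h : ∀ a : S, ∃ (M : Type v) (_ : Monoid M) (f : S → M),
      Function.Injective f ∧ (∀ x y : S, f (x * y) = f x * f y) ∧ IsUnit (f a)) :
    ∃ (G : Type (max u v)) (_ : Group G) (f : S → G),
      Function.Injective f ∧ ∀ x y : S, f (x * y) = f x * f y := by
  classical
  choose p hp using exists_forall_isUnit_of_isUnit (S := S)
  choose M hM f hinj hmul hunit using fun F : Finset S => h (p F)
  have hu (s : S) : IsUnit
      ((fun F => f F s : ∀ F, M F) : (Con.eventuallyEq Filter.atTop M).Quotient) := by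
    refine Con.isUnit_eventuallyEq_mk ?_
    filter_upwards [Filter.eventually_ge_atTop {s}] with F hF
    exact hp F (M F) (f F) (hmul F) (hunit F) s (Finset.singleton_subset_iff.1 hF)
  refine ⟨(Con.eventuallyEq Filter.atTop M).Quotientˣ, inferInstance, fun s => (hu s).unit,
    fun a b hab => ?_, fun x y => Units.ext ?_⟩
  · obtain ⟨F, hF⟩ := ((Con.eq _).1 (congrArg Units.val hab)).exists
    exact hinj F hF
  · exact (Con.eq _).2 (.of_forall fun F => hmul F x y)

/-- **Shutov's theorem.** If every element of a semigroup `S` is potentially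
invertible (i.e. for every `a ∈ S` there is a monoid `M` and an injective
multiplication-preserving map `f : S → M` with `f a` a unit), then `S` embeds
into a group. -/
theorem potentially_invertible_embeds_into_group {S : Type*} [Semigroup S]
    (h : ∀ a : S, ∃ (M : Type) (_ : Monoid M) (f : S → M),
      Function.Injective f ∧ (∀ x y : S, f (x * y) = f x * f y) ∧ IsUnit (f a)) :
    ∃ (G : Type) (_ : Group G) (f : S → G),
      Function.Injective f ∧ ∀ x y : S, f (x * y) = f x * f y := by
  rcases isEmpty_or_nonempty S with hS | hS
  · exact ⟨Unit, inferInstance, fun _ => (), fun a => isEmptyElim a, fun a => isEmptyElim a⟩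
  obtain ⟨M₀, _, f₀, hf₀, -⟩ := h (Classical.arbitrary S)
  have : Small.{0} S := small_of_injective hf₀
  let e : Shrink.{0} S ≃* S := Shrink.mulEquiv
  have : Nonempty (Shrink.{0} S) := ⟨e.symm (Classical.arbitrary S)⟩
  obtain ⟨G, hG, g, hg, hgmul⟩ :=
    exists_group_embedding_of_potentially_invertible (S := Shrink.{0} S) fun a => by
      obtain ⟨M, hM, f, hf, hmul, hu⟩ := h (e a)
      exact ⟨M, hM, f ∘ e, hf.comp e.injective, fun x y => by simp [hmul], hu⟩
  exact ⟨G, hG, g ∘ e.symm, hg.comp e.symm.injective, fun x y => by simp [hgmul]⟩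
end

section
/- Not every semigroup can be embedded into the power semigroup of a periodic group: there exists a semigroup S such that for every periodic group G there is no injective multiplication-preserving map from S into the semigroup of nonempty subsets of G under setwise multiplication. -/
open Pointwise

/-- A nonempty idempotent subset of a torsion group contains the identity. -/
theorem Monoid.IsTorsion.one_mem_of_mul_self_eq {G : Type*} [Group G] (hG : Monoid.IsTorsion G)
    {A : Set G} (hA : A.Nonempty) (hAA : A * A = A) : (1 : G) ∈ A := by
  obtain ⟨a, ha⟩ := hA
  have hpow : ∀ n : ℕ, a ^ (n + 1) ∈ A := by
    intro n
    induction n with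
    | zero => simpa using ha
    | succ n ih =>
      rw [pow_succ, ← hAA]
      exact Set.mul_mem_mul ih ha
  obtain ⟨n, hn⟩ := Nat.exists_eq_succ_of_ne_zero (hG a).orderOf_pos.ne'
  rw [← pow_orderOf_eq_one a, hn]
  exact hpow n

/-- Not every semigroup can be embedded into the power semigroup of a periodic
group: there is a semigroup `S` such that for every periodic (torsion) group
`G` there is no injective multiplication-preserving map from `S` into the
nonempty subsets of `G` under setwise multiplication. -/
theorem exists_semigroup_not_embeddable_into_power_of_periodic_group :
    ∃ (S : Type) (_ : Semigroup S),
      ∀ (G : Type) (_ : Group G), Monoid.IsTorsion G →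
        ¬ ∃ f : S → Set G,
            Function.Injective f ∧ (∀ a : S, (f a).Nonempty) ∧
            ∀ a b : S, f (a * b) = f a * f b := by
  -- The two-element left zero semigroup.
  refine ⟨Bool, { mul := fun a _ => a, mul_assoc := fun _ _ _ => rfl }, ?_⟩
  rintro G _ hG ⟨f, hinj, hne, hmul⟩
  have hleft : ∀ a b : Bool, f a = f a * f b := hmul
  have hone : ∀ a : Bool, (1 : G) ∈ f a := fun a =>
    hG.one_mem_of_mul_self_eq (hne a) (hleft a a).symm
  have hsub : ∀ a b : Bool, f b ⊆ f a := by
    intro a b x hx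
    rw [hleft a b]
    simpa using Set.mul_mem_mul (hone a) hx
  exact Bool.false_ne_true (hinj ((hsub true false).antisymm (hsub false true)))
end

section
/- There exist two semigroups S₁ and S₂ that are not isomorphic but whose power semigroups P(S₁) and P(S₂) are isomorphic as semigroups. -/
open Pointwise

/-- The power semigroup of a semigroup `S`: all nonempty subsets of `S` under
setwise multiplication. -/
def PowerSemigroup (S : Type*) [Semigroup S] : Type _ := {A : Set S // A.Nonempty}

noncomputable instance (S : Type*) [Semigroup S] : Semigroup (PowerSemigroup S) where
  mul A B := ⟨A.1 * B.1, A.2.mul B.2⟩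
  mul_assoc A B C := Subtype.ext (mul_assoc A.1 B.1 C.1)

/-- Two retractions with equinumerous fibres over corresponding points are conjugate. -/
theorem exists_equiv_commute_of_fiber_equiv {X₁ X₂ Z₁ Z₂ : Type*}
    (G₁ : X₁ → Z₁) (i₁ : Z₁ → X₁) (h₁ : ∀ z, G₁ (i₁ z) = z)
    (G₂ : X₂ → Z₂) (i₂ : Z₂ → X₂) (h₂ : ∀ z, G₂ (i₂ z) = z) (σ : Z₁ ≃ Z₂)
    (hσ : ∀ z, Nonempty ({a // G₁ a = z} ≃ {b // G₂ b = σ z})) :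
    ∃ e : X₁ ≃ X₂, ∀ a, e (i₁ (G₁ a)) = i₂ (G₂ (e a)) := by
  classical
  have pointed : ∀ z, ∃ E : {a // G₁ a = z} ≃ {b // G₂ b = σ z},
      E ⟨i₁ z, h₁ z⟩ = ⟨i₂ (σ z), h₂ _⟩ := fun z => by
    obtain ⟨E⟩ := hσ z
    exact ⟨E.trans (Equiv.swap (E ⟨i₁ z, h₁ z⟩) ⟨i₂ (σ z), h₂ _⟩), by simp⟩
  choose E hE using pointed
  let e : X₁ ≃ X₂ := (Equiv.sigmaFiberEquiv G₁).symm.trans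
    ((Equiv.sigmaCongr σ E).trans (Equiv.sigmaFiberEquiv G₂))
  have he : ∀ z (a : {a // G₁ a = z}), e a = E z a := by
    rintro _ ⟨a, rfl⟩
    rfl
  refine ⟨e, fun a => ?_⟩
  rw [he (G₁ a) ⟨i₁ (G₁ a), h₁ _⟩, hE, he (G₁ a) ⟨a, rfl⟩, (E (G₁ a) ⟨a, rfl⟩).2]

/-- A type squeezed between `Set ℕ` and the power set of a countable type has the cardinality
of the continuum. -/
theorem nonempty_equiv_set_nat {T C : Type*} [Countable C] (f : Set ℕ → T)
    (hf : Function.Injective f) (g : T → Set C) (hg : Function.Injective g) :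
    Nonempty (T ≃ Set ℕ) := by
  obtain ⟨c, hc⟩ := exists_injective_nat C
  exact Function.Embedding.antisymm ⟨fun t => c '' g t, hc.image_injective.comp hg⟩ ⟨f, hf⟩

/-- The left zero semigroup on `ℕ ⊕ K` in which every point of `K` is inflated to a copy of `ℕ`,
with `(k, 0)` representing `k`. -/
def InflatedLeftZero (K : Type) : Type := ℕ ⊕ K × ℕ

namespace InflatedLeftZero

variable {K : Type}

/-- The projection of the inflation onto the underlying left zero semigroup. -/
def proj : InflatedLeftZero K → ℕ ⊕ K := Sum.map id Prod.fst

/-- The embedding of the underlying left zero semigroup. -/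
def incl : ℕ ⊕ K → InflatedLeftZero K := Sum.map id (fun k => (k, 0))

theorem proj_incl (y : ℕ ⊕ K) : proj (incl y) = y := by
  cases y <;> rfl

instance : Semigroup (InflatedLeftZero K) where
  mul x _ := incl (proj x)
  mul_assoc x _ _ := congrArg incl (proj_incl (proj x))

theorem mul_def (x y : InflatedLeftZero K) : x * y = incl (proj x) := rfl

instance [Countable K] : Countable (InflatedLeftZero K) :=
  inferInstanceAs (Countable (ℕ ⊕ K × ℕ))

/-- The `n`-th point in the inflation of `k`. -/
def copy (k : K) (n : ℕ) : InflatedLeftZero K := Sum.inr (k, n)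

/-- The projection on nonempty subsets. -/
def setProj (A : PowerSemigroup (InflatedLeftZero K)) : {Z : Set (ℕ ⊕ K) // Z.Nonempty} :=
  ⟨proj '' A.1, A.2.image _⟩

/-- The embedding on nonempty subsets. -/
def setIncl (Z : {Z : Set (ℕ ⊕ K) // Z.Nonempty}) : PowerSemigroup (InflatedLeftZero K) :=
  ⟨incl '' Z.1, Z.2.image _⟩

theorem setProj_setIncl (Z : {Z : Set (ℕ ⊕ K) // Z.Nonempty}) : setProj (setIncl Z) = Z := by
  apply Subtype.ext
  simp [setProj, setIncl, Set.image_image, proj_incl]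

theorem powerSemigroup_mul_eq (A B : PowerSemigroup (InflatedLeftZero K)) :
    A * B = setIncl (setProj A) := by
  apply Subtype.ext
  change A.1 * B.1 = incl '' (proj '' A.1)
  obtain ⟨b, hb⟩ := B.2
  ext x
  simp only [Set.mem_mul, mul_def, Set.mem_image, exists_exists_and_eq_and]
  exact ⟨fun ⟨a, ha, _, _, h⟩ => ⟨a, ha, h⟩, fun ⟨a, ha, h⟩ => ⟨a, ha, b, hb, h⟩⟩

/-- The subsets that meet the inflated part. -/
def MeetsInflated (Z : {Z : Set (ℕ ⊕ K) // Z.Nonempty}) : Prop := ∃ k, Sum.inr k ∈ Z.1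

theorem nonempty_meetsInflated_equiv [Countable K] [Nonempty K] :
    Nonempty ({Z : {Z : Set (ℕ ⊕ K) // Z.Nonempty} // MeetsInflated Z} ≃ Set ℕ) := by
  obtain ⟨k⟩ := ‹Nonempty K›
  refine nonempty_equiv_set_nat
    (fun U => ⟨⟨insert (Sum.inr k) (Sum.inl '' U), Set.insert_nonempty _ _⟩,
      k, Set.mem_insert _ _⟩) (fun U V h => ?_)
    (fun Z => Z.1.1) (Subtype.val_injective.comp Subtype.val_injective)
  ext n
  have := Set.ext_iff.1 (congrArg (fun Z => Z.1.1) h) (Sum.inl n)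
  simpa using this

theorem nonempty_not_meetsInflated_equiv [Countable K] :
    Nonempty ({Z : {Z : Set (ℕ ⊕ K) // Z.Nonempty} // ¬ MeetsInflated Z} ≃ Set ℕ) := by
  refine nonempty_equiv_set_nat
    (fun U => ⟨⟨insert (Sum.inl 0) ((fun n => Sum.inl (n + 1)) '' U), Set.insert_nonempty _ _⟩,
      by simp [MeetsInflated]⟩) (fun U V h => ?_)
    (fun Z => Z.1.1) (Subtype.val_injective.comp Subtype.val_injective)
  ext n
  have := Set.ext_iff.1 (congrArg (fun Z => Z.1.1) h) (Sum.inl (n + 1))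
  simpa using this

theorem nonempty_fiber_equiv_of_meetsInflated [Countable K]
    {Z : {Z : Set (ℕ ⊕ K) // Z.Nonempty}} (hZ : MeetsInflated Z) :
    Nonempty ({A : PowerSemigroup (InflatedLeftZero K) // setProj A = Z} ≃ Set ℕ) := by
  obtain ⟨k, hk⟩ := hZ
  let thicken (U : Set ℕ) : Set (InflatedLeftZero K) :=
    incl '' Z.1 ∪ (fun n => copy k (n + 1)) '' U
  have proj_thicken (U : Set ℕ) : proj '' thicken U = Z.1 := by
    rw [Set.image_union, Set.image_image, Set.image_image]
    simp only [proj_incl, Set.image_id']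
    refine Set.union_eq_self_of_subset_right ?_
    rintro _ ⟨n, _, rfl⟩
    exact hk
  have mem_thicken (U : Set ℕ) (n : ℕ) :
      copy k (n + 1) ∈ thicken U ↔ n ∈ U := by
    constructor
    · rintro (⟨y | y, _, h⟩ | ⟨m, hm, h⟩)
      · cases h
      · cases h
      · cases h
        exact hm
    · exact fun h => Or.inr ⟨n, h, rfl⟩
  refine nonempty_equiv_set_nat
    (fun U => ⟨⟨thicken U, (Z.2.image _).mono Set.subset_union_left⟩,
      Subtype.ext (proj_thicken U)⟩) (fun U V h => ?_)
    (fun A => A.1.1) (Subtype.val_injective.comp Subtype.val_injective)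
  have h' : thicken U = thicken V := congrArg (fun A => A.1.1) h
  ext n
  rw [← mem_thicken U, h', mem_thicken V]

theorem nonempty_fiber_equiv_of_not_meetsInflated
    {Z : {Z : Set (ℕ ⊕ K) // Z.Nonempty}} (hZ : ¬ MeetsInflated Z) :
    Nonempty ({A : PowerSemigroup (InflatedLeftZero K) // setProj A = Z} ≃ Unit) := by
  have key (A : PowerSemigroup (InflatedLeftZero K)) (hA : setProj A = Z) : A = setIncl Z := by
    subst hA
    apply Subtype.ext
    change A.1 = incl '' (proj '' A.1)
    rw [Set.image_image]
    refine (Set.image_id' A.1).symm.trans (Set.image_congr ?_)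
    rintro (n | ⟨k, n⟩) ha
    · rfl
    · exact absurd ⟨k, _, ha, rfl⟩ hZ
  exact ⟨⟨fun _ => (), fun _ => ⟨setIncl Z, setProj_setIncl Z⟩,
    fun A => Subtype.ext (key A.1 A.2).symm, fun _ => rfl⟩⟩

theorem exists_powerSemigroup_equiv (K₁ K₂ : Type) [Countable K₁] [Nonempty K₁] [Countable K₂]
    [Nonempty K₂] :
    ∃ e : PowerSemigroup (InflatedLeftZero K₁) ≃ PowerSemigroup (InflatedLeftZero K₂),
      ∀ A B, e (A * B) = e A * e B := by
  classical
  obtain ⟨m₁⟩ := nonempty_meetsInflated_equiv (K := K₁)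
  obtain ⟨m₂⟩ := nonempty_meetsInflated_equiv (K := K₂)
  obtain ⟨n₁⟩ := nonempty_not_meetsInflated_equiv (K := K₁)
  obtain ⟨n₂⟩ := nonempty_not_meetsInflated_equiv (K := K₂)
  let σ : {Z : Set (ℕ ⊕ K₁) // Z.Nonempty} ≃ {Z : Set (ℕ ⊕ K₂) // Z.Nonempty} :=
    (Equiv.sumCompl MeetsInflated).symm.trans
      ((Equiv.sumCongr (m₁.trans m₂.symm) (n₁.trans n₂.symm)).trans
        (Equiv.sumCompl MeetsInflated))
  obtain ⟨e, he⟩ := exists_equiv_commute_of_fiber_equiv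
    (setProj (K := K₁)) setIncl setProj_setIncl
    (setProj (K := K₂)) setIncl setProj_setIncl σ (fun Z => by
      by_cases hZ : MeetsInflated Z
      · have hσ : MeetsInflated (σ Z) := by
          simp only [σ, Equiv.trans_apply, Equiv.sumCompl_symm_apply_of_pos hZ,
            Equiv.sumCongr_apply, Sum.map_inl, Equiv.sumCompl_apply_inl]
          exact (m₂.symm _).2
        obtain ⟨a⟩ := nonempty_fiber_equiv_of_meetsInflated hZ
        obtain ⟨b⟩ := nonempty_fiber_equiv_of_meetsInflated hσ
        exact ⟨a.trans b.symm⟩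
      · have hσ : ¬ MeetsInflated (σ Z) := by
          simp only [σ, Equiv.trans_apply, Equiv.sumCompl_symm_apply_of_neg hZ,
            Equiv.sumCongr_apply, Sum.map_inr, Equiv.sumCompl_apply_inr]
          exact (n₂.symm _).2
        obtain ⟨a⟩ := nonempty_fiber_equiv_of_not_meetsInflated hZ
        obtain ⟨b⟩ := nonempty_fiber_equiv_of_not_meetsInflated hσ
        exact ⟨a.trans b.symm⟩)
  exact ⟨e, fun A B => by rw [powerSemigroup_mul_eq, powerSemigroup_mul_eq, he]⟩

theorem mul_self_eq_of_mul_self_ne [Subsingleton K] {x y : InflatedLeftZero K}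
    (hx : x * x ≠ x) (hy : y * y ≠ y) : x * x = y * y := by
  rcases x with n | ⟨k, n⟩
  · exact absurd rfl hx
  rcases y with m | ⟨l, m⟩
  · exact absurd rfl hy
  exact congrArg (fun k => copy k 0) (Subsingleton.elim k l)

theorem not_exists_bijective_mul (K₁ K₂ : Type) [Nontrivial K₁] [Subsingleton K₂] :
    ¬ ∃ e : InflatedLeftZero K₁ → InflatedLeftZero K₂,
      Function.Bijective e ∧ ∀ x y, e (x * y) = e x * e y := by
  rintro ⟨e, he, hmul⟩
  obtain ⟨k, l, hkl⟩ := exists_pair_ne K₁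
  have hne (j : K₁) : e (copy j 1) * e (copy j 1) ≠ e (copy j 1) := by
    rw [← hmul, he.injective.ne_iff]
    exact fun h => by cases h
  have h := mul_self_eq_of_mul_self_ne (hne k) (hne l)
  rw [← hmul, ← hmul] at h
  exact hkl (congrArg Prod.fst (Sum.inr_injective (he.injective h)))

end InflatedLeftZero

/-- **Mogilyanskaya's theorem.** There exist two non-isomorphic semigroups
whose power semigroups are isomorphic. -/
theorem exists_nonisomorphic_semigroups_with_isomorphic_power_semigroups :
    ∃ (S₁ S₂ : Type) (_ : Semigroup S₁) (_ : Semigroup S₂),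
      (¬ ∃ e : S₁ → S₂, Function.Bijective e ∧ ∀ x y : S₁, e (x * y) = e x * e y) ∧
      ∃ e : PowerSemigroup S₁ → PowerSemigroup S₂,
        Function.Bijective e ∧ ∀ A B : PowerSemigroup S₁, e (A * B) = e A * e B := by
  obtain ⟨e, he⟩ := InflatedLeftZero.exists_powerSemigroup_equiv Bool Unit
  exact ⟨InflatedLeftZero Bool, InflatedLeftZero Unit, inferInstance, inferInstance,
    InflatedLeftZero.not_exists_bijective_mul Bool Unit, e, e.bijective, he⟩
end

section
/- There exist arbitrarily large finite semigroups with exactly eight endomorphisms: for every natural number n there exists a finite semigroup S with at least n elements such that the set of endomorphisms of S has exactly eight elements. -/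
/-- Nonempty alternating words in two letters `true` and `false`, given by their first letter and
the number of letter changes. -/
@[ext]
structure AltWord where
  head : Bool
  changes : ℕ

namespace AltWord

/-- The last letter of an alternating word. -/
def last (a : AltWord) : Bool := xor a.head a.changes.bodd

/-- Concatenation, where two equal adjacent letters are merged. -/
instance : Mul AltWord :=
  ⟨fun a b => ⟨a.head, a.changes + b.changes + (xor a.last b.head).toNat⟩⟩

@[simp] theorem head_mul (a b : AltWord) : (a * b).head = a.head := rfl

@[simp] theorem changes_mul (a b : AltWord) :
    (a * b).changes = a.changes + b.changes + (xor a.last b.head).toNat := rfl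

@[simp] theorem last_mul (a b : AltWord) : (a * b).last = b.last := by
  have h : ∀ x : Bool, Nat.bodd x.toNat = x := by decide
  simp only [last, head_mul, changes_mul, Nat.bodd_add, h]
  cases a.head <;> cases b.head <;> cases a.changes.bodd <;> cases b.changes.bodd <;> rfl

/-- The free product of two one-element semigroups. -/
instance : Semigroup AltWord where
  mul_assoc a b c := by
    ext
    · rfl
    · simp only [changes_mul, last_mul, head_mul]; omega

/-- The word consisting of a single letter. -/
def letter (s : Bool) : AltWord := ⟨s, 0⟩

theorem letter_mul_letter (s : Bool) : letter s * letter s = letter s := by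
  cases s <;> rfl

theorem mk_succ (s : Bool) (d : ℕ) : (⟨s, d + 1⟩ : AltWord) = letter s * ⟨!s, d⟩ := by
  cases s <;> ext <;> simp [letter, last]

/-- Two multiplicative maps on alternating words that agree on letters are equal. -/
theorem eq_of_letter {T : Type*} [Mul T] {f g : AltWord → T}
    (hf : ∀ a b, f (a * b) = f a * f b) (hg : ∀ a b, g (a * b) = g a * g b)
    (h : ∀ s, f (letter s) = g (letter s)) (a : AltWord) : f a = g a := by
  obtain ⟨s, d⟩ := a
  induction d generalizing s with
  | zero => exact h s
  | succ d ih => rw [mk_succ, hf, hg, ih, h]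

/-- Exchange of the two letters. -/
def swap (a : AltWord) : AltWord := ⟨!a.head, a.changes⟩

theorem swap_mul (a b : AltWord) : (a * b).swap = a.swap * b.swap := by
  ext
  · rfl
  · simp [swap, last]

/-- The words with more than `N` changes, together with the word with exactly `N` changes that
starts with `false`. -/
def IsLong (N : ℕ) (a : AltWord) : Prop := N + a.head.toNat ≤ a.changes

theorem IsLong.mul_right {N : ℕ} {a : AltWord} (h : a.IsLong N) (b : AltWord) :
    (a * b).IsLong N := by
  simp only [IsLong, head_mul, changes_mul] at *; omega

theorem IsLong.mul_left {N : ℕ} {a : AltWord} (h : a.IsLong N) (b : AltWord) :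
    (b * a).IsLong N := by
  obtain ⟨s, d⟩ := a
  obtain ⟨t, k⟩ := b
  simp only [IsLong, head_mul, changes_mul, last] at *
  cases k with
  | zero => cases s <;> cases t <;> simp at * <;> omega
  | succ k => have := t.toNat_le; omega

/-- The Rees congruence collapsing all long words. -/
def longCon (N : ℕ) : Con AltWord where
  r a b := a = b ∨ a.IsLong N ∧ b.IsLong N
  iseqv :=
    { refl := fun _ => Or.inl rfl
      symm := by
        rintro a b (rfl | ⟨h, k⟩)
        exacts [Or.inl rfl, Or.inr ⟨k, h⟩]
      trans := by
        rintro a b c (rfl | ⟨h, k⟩) (rfl | ⟨h', k'⟩)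
        exacts [Or.inl rfl, Or.inr ⟨h', k'⟩, Or.inr ⟨h, k⟩, Or.inr ⟨h, k'⟩] }
  mul' := by
    rintro a b c d (rfl | ⟨h, k⟩) (rfl | ⟨h', k'⟩)
    exacts [Or.inl rfl, Or.inr ⟨h'.mul_left _, k'.mul_left _⟩,
      Or.inr ⟨h.mul_right _, k.mul_right _⟩, Or.inr ⟨h.mul_right _, k.mul_right _⟩]

/-- Alternating words with all long words identified to a zero element. -/
abbrev Truncated (N : ℕ) : Type := (longCon N).Quotient

/-- The class of a word. -/
def toTruncated (N : ℕ) (a : AltWord) : Truncated N := (a : (longCon N).Quotient)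

variable {N : ℕ}

theorem toTruncated_mul (a b : AltWord) :
    toTruncated N (a * b) = toTruncated N a * toTruncated N b := rfl

theorem toTruncated_eq {a b : AltWord} :
    toTruncated N a = toTruncated N b ↔ a = b ∨ a.IsLong N ∧ b.IsLong N :=
  (longCon N).eq

theorem toTruncated_surjective : Function.Surjective (toTruncated N) :=
  Quotient.mk''_surjective

/-- A long word, representing the zero element. -/
def long (N : ℕ) : AltWord := ⟨true, N + 1⟩

theorem isLong_long : (long N).IsLong N := le_rfl

theorem IsLong.toTruncated_eq_long {a : AltWord} (h : a.IsLong N) :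
    toTruncated N a = toTruncated N (long N) :=
  toTruncated_eq.2 (Or.inr ⟨h, isLong_long⟩)

instance : Finite (Truncated N) := by
  refine Finite.of_surjective
    (fun p : Bool × Fin (N + 2) => toTruncated N ⟨p.1, p.2⟩) fun x => ?_
  obtain ⟨⟨s, d⟩, rfl⟩ := toTruncated_surjective x
  by_cases h : d < N + 2
  · exact ⟨(s, ⟨d, h⟩), rfl⟩
  · refine ⟨(true, ⟨N + 1, by omega⟩), (IsLong.toTruncated_eq_long ?_).symm⟩
    have := s.toNat_le
    simp only [IsLong]; omega

theorem le_card_truncated : N ≤ Nat.card (Truncated N) := by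
  have h : Function.Injective fun i : Fin N => toTruncated N ⟨true, i⟩ := by
    intro i j hij
    rcases toTruncated_eq.1 hij with h | ⟨h, -⟩
    · exact Fin.ext (congrArg changes h)
    · have := i.2
      simp [IsLong] at h; omega
  simpa using Nat.card_le_card_of_injective _ h

theorem not_isLong_letter (hN : N ≠ 0) (s : Bool) : ¬ (letter s).IsLong N := by
  simp [IsLong, letter, hN]

/-- The zero and the two letters, which are all the idempotents when `N ≠ 0`. -/
def idem (N : ℕ) : Fin 3 → Truncated N :=
  ![toTruncated N (long N), toTruncated N (letter true), toTruncated N (letter false)]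

theorem idem_injective (hN : N ≠ 0) : Function.Injective (idem N) := by
  have h (s : Bool) : toTruncated N (letter s) ≠ toTruncated N (long N) := by
    rw [Ne, toTruncated_eq]
    rintro (h | h)
    · exact absurd (congrArg changes h) (by simp [letter, long])
    · exact not_isLong_letter hN s h.1
  have h' : toTruncated N (letter true) ≠ toTruncated N (letter false) := by
    rw [Ne, toTruncated_eq]
    rintro (h | h)
    · exact absurd (congrArg head h) (by simp [letter])
    · exact not_isLong_letter hN _ h.1
  intro i j
  fin_cases i <;> fin_cases j <;> simp [idem, h, h', h'.symm, (h _).symm]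

theorem long_mul (x : Truncated N) :
    toTruncated N (long N) * x = toTruncated N (long N) := by
  obtain ⟨a, rfl⟩ := toTruncated_surjective x
  exact (isLong_long.mul_right a).toTruncated_eq_long

theorem mul_long (x : Truncated N) :
    x * toTruncated N (long N) = toTruncated N (long N) := by
  obtain ⟨a, rfl⟩ := toTruncated_surjective x
  exact (isLong_long.mul_left a).toTruncated_eq_long

theorem idem_mul_idem (i : Fin 3) : idem N i * idem N i = idem N i := by
  fin_cases i
  · exact long_mul _
  · exact congrArg (toTruncated N) (letter_mul_letter true)
  · exact congrArg (toTruncated N) (letter_mul_letter false)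

theorem exists_idem_eq {x : Truncated N} (hx : x * x = x) : ∃ i, idem N i = x := by
  obtain ⟨⟨s, d⟩, rfl⟩ := toTruncated_surjective x
  rw [← toTruncated_mul, toTruncated_eq] at hx
  rcases hx with h | h
  · have := congrArg changes h
    simp only [changes_mul] at this
    obtain rfl : d = 0 := by omega
    cases s
    exacts [⟨2, rfl⟩, ⟨1, rfl⟩]
  · exact ⟨0, h.2.toTruncated_eq_long.symm⟩

theorem idem_comm {i j : Fin 3} (h₁ : (i, j) ≠ (1, 2)) (h₂ : (i, j) ≠ (2, 1)) :
    idem N i * idem N j = idem N j * idem N i := by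
  fin_cases i <;> fin_cases j <;>
    first
    | rfl
    | exact absurd rfl h₁
    | exact absurd rfl h₂
    | exact (long_mul _).trans (mul_long _).symm
    | exact (mul_long _).trans (long_mul _).symm

/-- The multiplicative map sending the letters to two given commuting idempotents. -/
def commLift {T : Type*} [Mul T] (x y : T) : AltWord → T
  | ⟨s, 0⟩ => bif s then x else y
  | ⟨_, _ + 1⟩ => x * y

theorem commLift_mul {T : Type*} [Semigroup T] {x y : T} (hx : x * x = x) (hy : y * y = y)
    (hxy : x * y = y * x) (a b : AltWord) :
    commLift x y (a * b) = commLift x y a * commLift x y b := by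
  have pos (c : AltWord) (hc : c.changes ≠ 0) : commLift x y c = x * y := by
    obtain ⟨s, _ | d⟩ := c
    · exact absurd rfl hc
    · rfl
  have h₁ : x * (x * y) = x * y := by rw [← mul_assoc, hx]
  have h₂ : x * y * y = x * y := by rw [mul_assoc, hy]
  have h₃ : y * (x * y) = x * y := by rw [hxy, ← mul_assoc, hy]
  have h₄ : x * y * x = x * y := by rw [mul_assoc, ← hxy, h₁]
  have h₅ : x * y * (x * y) = x * y := by rw [← mul_assoc, h₄, h₂]
  obtain ⟨s, _ | d⟩ := a <;> obtain ⟨t, _ | k⟩ := b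
  · cases s <;> cases t
    exacts [hy.symm, hxy, rfl, hx.symm]
  · rw [pos _ (by simp)]
    cases s
    exacts [h₃.symm, h₁.symm]
  · rw [pos _ (by simp)]
    cases t
    exacts [h₂.symm, h₄.symm]
  · rw [pos _ (by simp)]
    exact h₅.symm

theorem exists_endomorphism_of_comm (hN : N ≠ 0) {x y : Truncated N} (hx : x * x = x)
    (hy : y * y = y) (hxy : x * y = y * x) :
    ∃ f : Truncated N → Truncated N, (∀ u v, f (u * v) = f u * f v) ∧
      f (toTruncated N (letter true)) = x ∧ f (toTruncated N (letter false)) = y := by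
  have long_eq (a : AltWord) (ha : a.IsLong N) : commLift x y a = x * y := by
    obtain ⟨s, _ | d⟩ := a
    · exact absurd ha (not_isLong_letter hN s)
    · rfl
  refine ⟨fun u => Quotient.liftOn u (commLift x y) ?_, ?_, rfl, rfl⟩
  · rintro a b (rfl | ⟨ha, hb⟩)
    · rfl
    · rw [long_eq a ha, long_eq b hb]
  · intro u v
    obtain ⟨a, rfl⟩ := toTruncated_surjective u
    obtain ⟨b, rfl⟩ := toTruncated_surjective v
    exact commLift_mul hx hy hxy a b

theorem exists_endomorphism (hN : N ≠ 0) {i j : Fin 3} (h : (i, j) ≠ (2, 1)) :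
    ∃ f : {f : Truncated N → Truncated N // ∀ u v, f (u * v) = f u * f v},
      f.1 (toTruncated N (letter true)) = idem N i ∧
        f.1 (toTruncated N (letter false)) = idem N j := by
  by_cases h' : (i, j) = (1, 2)
  · obtain ⟨rfl, rfl⟩ := Prod.mk.inj h'
    exact ⟨⟨id, fun _ _ => rfl⟩, rfl, rfl⟩
  · obtain ⟨f, hf, hx, hy⟩ := exists_endomorphism_of_comm hN (idem_mul_idem i)
      (idem_mul_idem j) (idem_comm h' h)
    exact ⟨⟨f, hf⟩, hx, hy⟩

theorem endomorphism_ext {f g : Truncated N → Truncated N}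
    (hf : ∀ u v, f (u * v) = f u * f v) (hg : ∀ u v, g (u * v) = g u * g v)
    (h : ∀ s, f (toTruncated N (letter s)) = g (toTruncated N (letter s))) : f = g := by
  funext u
  obtain ⟨a, rfl⟩ := toTruncated_surjective u
  exact eq_of_letter (f := f ∘ toTruncated N) (g := g ∘ toTruncated N)
    (fun a b => hf (toTruncated N a) (toTruncated N b))
    (fun a b => hg (toTruncated N a) (toTruncated N b)) h a

/-- No endomorphism exchanges the two letters. -/
theorem not_swap_letters {f : Truncated N → Truncated N}
    (hf : ∀ u v, f (u * v) = f u * f v)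
    (h : ∀ s, f (toTruncated N (letter s)) = toTruncated N (letter !s)) : False := by
  have key := eq_of_letter (f := f ∘ toTruncated N) (g := toTruncated N ∘ swap)
    (fun a b => hf (toTruncated N a) (toTruncated N b))
    (fun a b => congrArg (toTruncated N) (swap_mul a b)) h
  have h₁ : toTruncated N ⟨false, N⟩ = toTruncated N ⟨false, N + 1⟩ :=
    toTruncated_eq.2 (Or.inr (by simp [IsLong]))
  have h₂ : toTruncated N ⟨true, N⟩ = toTruncated N ⟨true, N + 1⟩ :=
    (key ⟨false, N⟩).symm.trans ((congrArg f h₁).trans (key ⟨false, N + 1⟩))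
  rcases toTruncated_eq.1 h₂ with h | h
  · exact absurd (congrArg changes h) (by simp)
  · exact absurd h.1 (by simp [IsLong])

theorem card_endomorphisms_truncated (hN : N ≠ 0) :
    Nat.card {f : Truncated N → Truncated N // ∀ u v, f (u * v) = f u * f v} = 8 := by
  choose F hF using fun q : {q : Fin 3 × Fin 3 // q ≠ (2, 1)} =>
    exists_endomorphism (N := N) hN (i := q.1.1) (j := q.1.2) q.2
  have bij : Function.Bijective F := by
    constructor
    · intro q r h
      apply Subtype.ext
      apply Prod.ext <;> apply idem_injective hN
      · rw [← (hF q).1, ← (hF r).1, h]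
      · rw [← (hF q).2, ← (hF r).2, h]
    · rintro ⟨f, hf⟩
      have idempotent (s : Bool) : f (toTruncated N (letter s)) * f (toTruncated N (letter s)) =
          f (toTruncated N (letter s)) := by
        rw [← hf, ← toTruncated_mul, letter_mul_letter]
      obtain ⟨i, hi⟩ := exists_idem_eq (idempotent true)
      obtain ⟨j, hj⟩ := exists_idem_eq (idempotent false)
      have hij : (i, j) ≠ (2, 1) := by
        intro h
        obtain ⟨rfl, rfl⟩ := Prod.mk.inj h
        refine not_swap_letters hf fun s => ?_
        cases s
        exacts [hj.symm, hi.symm]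
      refine ⟨⟨(i, j), hij⟩, Subtype.ext (endomorphism_ext (F _).2 hf fun s => ?_)⟩
      cases s
      exacts [(hF ⟨(i, j), hij⟩).2.trans hj, (hF ⟨(i, j), hij⟩).1.trans hi]
  rw [← Nat.card_eq_of_bijective F bij, Nat.card_eq_fintype_card]
  decide

end AltWord

/-- **Dlab–Neumann.** There exist arbitrarily large finite semigroups with
exactly eight endomorphisms. -/
theorem arbitrarily_large_finite_semigroups_with_eight_endomorphisms (n : ℕ) :
    ∃ (S : Type) (_ : Semigroup S), Finite S ∧ n ≤ Nat.card S ∧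
      Nat.card {f : S → S // ∀ x y : S, f (x * y) = f x * f y} = 8 :=
  ⟨AltWord.Truncated (n + 1), inferInstance, inferInstance,
    (Nat.le_succ n).trans AltWord.le_card_truncated,
    AltWord.card_endomorphisms_truncated n.succ_ne_zero⟩
end

section
/- Every finite semigroup with at least four elements has at least four endomorphisms. -/
theorem four_le_card_of_pairwise_ne {α : Type*} [Finite α] (a b c d : α)
    (hab : a ≠ b) (hac : a ≠ c) (had : a ≠ d) (hbc : b ≠ c) (hbd : b ≠ d) (hcd : c ≠ d) :
    4 ≤ Nat.card α := by
  classical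
  have : Fintype α := Fintype.ofFinite α
  rw [Nat.card_eq_fintype_card]
  have h : ({a, b, c, d} : Finset α).card = 4 := by
    simp [*]
  exact h ▸ Finset.card_le_univ _

theorem exists_ne_of_four_le_card {α : Type*} [Finite α] (h : 4 ≤ Nat.card α) (a b c : α) :
    ∃ x, x ≠ a ∧ x ≠ b ∧ x ≠ c := by
  classical
  have : Fintype α := Fintype.ofFinite α
  rw [Nat.card_eq_fintype_card] at h
  obtain ⟨x, -, hx⟩ := Finset.exists_mem_notMem_of_card_lt_card
    (s := {a, b, c}) (t := Finset.univ) (Finset.card_le_three.trans_lt h)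
  exact ⟨x, by simpa using hx⟩

theorem card_le_card_end_of_commGroup (G : Type*) [CommGroup G] [Finite G] :
    Nat.card G ≤ Nat.card (G →* G) := by
  obtain ⟨a, ha⟩ := Monoid.exists_orderOf_eq_exponent (Monoid.ExponentExists.of_finite (G := G))
  have hn : NeZero (Monoid.exponent G) := ⟨Monoid.exponent_ne_zero_of_finite⟩
  rw [← CommGroup.card_monoidHom_of_hasEnoughRootsOfUnity G ℂ]
  have e : rootsOfUnity (Monoid.exponent G) ℂ ≃* Subgroup.zpowers a :=
    mulEquivOfCyclicCardEq (by
      rw [Nat.card_zpowers, ha, Complex.card_rootsOfUnity])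
  have hmem (φ : G →* ℂˣ) (x : G) : φ x ∈ rootsOfUnity (Monoid.exponent G) ℂ := by
    rw [mem_rootsOfUnity, ← map_pow, Monoid.pow_exponent_eq_one, map_one]
  have : Finite (G →* G) := DFunLike.finite _
  refine Nat.card_le_card_of_injective
    (fun φ : G →* ℂˣ => (Subgroup.zpowers a).subtype.comp
      (e.toMonoidHom.comp (φ.codRestrict _ (hmem φ)))) fun φ ψ h => ?_
  ext x
  have := DFunLike.congr_fun h x
  simpa [Units.ext_iff] using this

theorem min_card_four_le_card_end (G : Type*) [Group G] [Finite G] :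
    min (Nat.card G) 4 ≤ Nat.card (G →* G) := by
  by_cases hc : ∀ a b : G, a * b = b * a
  · let : CommGroup G := { mul_comm := hc }
    exact (min_le_left _ _).trans (card_le_card_end_of_commGroup G)
  · push Not at hc
    obtain ⟨a, b, hab⟩ := hc
    refine (min_le_right _ _).trans ?_
    have : Finite (G →* G) := DFunLike.finite _
    let c (g : G) : G →* G := (MulAut.conj g).toMonoidHom
    have hne {g h : G} (x : G) (H : g⁻¹ * (h * x) ≠ x * (g⁻¹ * h)) : c g ≠ c h := by
      intro h'
      have : g * x * g⁻¹ = h * x * h⁻¹ := DFunLike.congr_fun h' x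
      apply H
      rw [eq_mul_inv_iff_mul_eq] at this
      rw [← this]
      group
    refine four_le_card_of_pairwise_ne (c 1) (c a) (c b) (c (a * b))
      (hne b ?_) (hne a ?_) (hne a ?_) (hne a ?_) (hne a ?_) (hne b ?_)
    case refine_6 => rw [ne_eq, inv_mul_eq_iff_eq_mul]; simpa [← mul_assoc] using hab
    all_goals simp [mul_assoc, inv_mul_eq_iff_eq_mul, hab, Ne.symm hab]

section Semigroup

variable {S : Type*} [Semigroup S]

/-- `succPow x n` is the power of `x` with exponent `n + 1`. -/
def succPow (x : S) : ℕ → S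
  | 0 => x
  | n + 1 => succPow x n * x

theorem succPow_mul_succPow (x : S) (m n : ℕ) :
    succPow x m * succPow x n = succPow x (m + n + 1) := by
  induction n with
  | zero => rfl
  | succ n ih => rw [succPow, ← mul_assoc, ih]; rfl

theorem succPow_mul_comm (x : S) (m n : ℕ) :
    succPow x m * succPow x n = succPow x n * succPow x m := by
  rw [succPow_mul_succPow, succPow_mul_succPow, add_comm m]

theorem self_mul_succPow (x : S) (n : ℕ) : x * succPow x n = succPow x n * x :=
  succPow_mul_comm x 0 n

theorem mul_succPow_of_mul_eq_mul {f x : S} (h : f * x = x * f) (n : ℕ) :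
    f * succPow x n = succPow x n * f := by
  induction n with
  | zero => exact h
  | succ n ih => rw [succPow, ← mul_assoc, ih, mul_assoc, h, mul_assoc]

theorem exists_succPow_mul_eq_mul_right (x y : S) (n : ℕ) :
    ∃ u, succPow (x * y) n = x * u := by
  induction n with
  | zero => exact ⟨y, rfl⟩
  | succ n ih => obtain ⟨u, hu⟩ := ih; exact ⟨u * (x * y), by rw [succPow, hu, mul_assoc]⟩

theorem exists_succPow_mul_eq_mul_left (x y : S) (n : ℕ) :
    ∃ u, succPow (x * y) n = u * y := by
  cases n with
  | zero => exact ⟨x, rfl⟩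
  | succ n => exact ⟨succPow (x * y) n * x, by rw [succPow, mul_assoc]⟩

theorem eq_succPow_mul_of_eq_mul {f x u : S} (h : f = x * f * u) (n : ℕ) :
    f = succPow x n * f * succPow u n := by
  induction n with
  | zero => exact h
  | succ n ih =>
    rw [succPow, succPow, ← self_mul_succPow u]
    calc f = succPow x n * (x * f * u) * succPow u n := by rw [← h, ← ih]
      _ = _ := by simp only [mul_assoc]

theorem exists_succPow_isIdempotentElem [Finite S] (x : S) :
    ∃ n, IsIdempotentElem (succPow x n) := by
  let : TopologicalSpace S := ⊥
  have : DiscreteTopology S := ⟨rfl⟩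
  obtain ⟨_, ⟨n, rfl⟩, hn⟩ := exists_idempotent_in_compact_subsemigroup
    (fun r : S => continuous_of_discreteTopology) (Set.range (succPow x)) (Set.range_nonempty _)
    (Set.toFinite _).isCompact (by
      rintro _ ⟨m, rfl⟩ _ ⟨n, rfl⟩
      exact ⟨_, (succPow_mul_succPow x m n).symm⟩)
  exact ⟨n, hn⟩

theorem IsIdempotentElem.succPow_eq {e : S} (he : IsIdempotentElem e) (n : ℕ) :
    succPow e n = e := by
  induction n with
  | zero => rfl
  | succ n ih => rw [succPow, ih, he.eq]

theorem four_le_card_endomorphisms_of_ne [Finite S] {f₁ f₂ f₃ f₄ : S → S}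
    (h₁ : ∀ x y, f₁ (x * y) = f₁ x * f₁ y) (h₂ : ∀ x y, f₂ (x * y) = f₂ x * f₂ y)
    (h₃ : ∀ x y, f₃ (x * y) = f₃ x * f₃ y) (h₄ : ∀ x y, f₄ (x * y) = f₄ x * f₄ y)
    (h₁₂ : f₁ ≠ f₂) (h₁₃ : f₁ ≠ f₃) (h₁₄ : f₁ ≠ f₄) (h₂₃ : f₂ ≠ f₃) (h₂₄ : f₂ ≠ f₄)
    (h₃₄ : f₃ ≠ f₄) :
    4 ≤ Nat.card {f : S → S // ∀ x y : S, f (x * y) = f x * f y} :=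
  four_le_card_of_pairwise_ne ⟨f₁, h₁⟩ ⟨f₂, h₂⟩ ⟨f₃, h₃⟩ ⟨f₄, h₄⟩
    (by simpa using h₁₂) (by simpa using h₁₃) (by simpa using h₁₄) (by simpa using h₂₃)
    (by simpa using h₂₄) (by simpa using h₃₄)

/-! ### Two idempotents -/

section TwoIdempotents

variable {e f : S}

theorem mul_eq_or_of_forall_isIdempotentElem [Finite S] (he : IsIdempotentElem e)
    (hf : IsIdempotentElem f) (hE : ∀ g : S, IsIdempotentElem g → g = e ∨ g = f) :
    e * f = e ∨ e * f = f := by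
  obtain ⟨n, hn⟩ := exists_succPow_isIdempotentElem (e * f)
  refine (hE _ hn).imp (fun h => ?_) (fun h => ?_)
  · obtain ⟨u, hu⟩ := exists_succPow_mul_eq_mul_left e f n
    rw [← h, hu, mul_assoc, hf.eq]
  · obtain ⟨u, hu⟩ := exists_succPow_mul_eq_mul_right e f n
    rw [← h, hu, ← mul_assoc, he.eq]

theorem succPow_mul_ne_of_left_zero (hef : e * f = e) (hfe : f * e = f) (hne : e ≠ f)
    (he : IsIdempotentElem e) (hf : IsIdempotentElem f)
    (hE : ∀ g : S, IsIdempotentElem g → g = e ∨ g = f) {x : S} {n : ℕ}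
    (hx : succPow x n = e) (y : S) (m : ℕ) : succPow (x * y) m ≠ f := by
  intro hxy
  obtain ⟨u, hu⟩ := exists_succPow_mul_eq_mul_right x y m
  replace hu : x * u = f := by rw [← hu, hxy]
  have hex : e * x = x * e := by rw [← hx, self_mul_succPow]
  have hidem : IsIdempotentElem (u * f * x) := by
    calc u * f * x * (u * f * x) = u * f * (x * u) * f * x := by simp only [mul_assoc]
      _ = u * f * x := by rw [hu, mul_assoc u, hf.eq, mul_assoc u, hf.eq]
  have hfx : f * x = x * (u * f * x) := by rw [← mul_assoc, ← mul_assoc, hu, hf.eq]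
  rcases hE _ hidem with h | h <;> rw [h] at hfx
  · have h1 (k : ℕ) : f * succPow x k = e * succPow x k := by
      cases k with
      | zero => rw [succPow, hfx, hex]
      | succ k => rw [succPow, ← self_mul_succPow, ← mul_assoc, ← mul_assoc, hfx, hex]
    have := h1 n
    rw [hx, hfe, he.eq] at this
    exact hne this.symm
  · have := mul_succPow_of_mul_eq_mul hfx n
    rw [hx, hfe, hef] at this
    exact hne this.symm

theorem succPow_mul_ne_of_right_zero (hef : e * f = f) (hfe : f * e = e) (hne : e ≠ f)
    (he : IsIdempotentElem e) (hf : IsIdempotentElem f)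
    (hE : ∀ g : S, IsIdempotentElem g → g = e ∨ g = f) (x : S) {y : S} {n : ℕ}
    (hy : succPow y n = e) (m : ℕ) : succPow (x * y) m ≠ f := by
  intro hxy
  obtain ⟨u, hu⟩ := exists_succPow_mul_eq_mul_left x y m
  replace hu : u * y = f := by rw [← hu, hxy]
  have hey : e * y = y * e := by rw [← hy, self_mul_succPow]
  have hidem : IsIdempotentElem (y * f * u) := by
    calc y * f * u * (y * f * u) = y * f * (u * y) * f * u := by simp only [mul_assoc]
      _ = y * f * u := by rw [hu, mul_assoc y, hf.eq, mul_assoc y, hf.eq]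
  have hyf : y * f = y * f * u * y := by rw [mul_assoc, hu, mul_assoc, hf.eq]
  rcases hE _ hidem with h | h <;> rw [h] at hyf
  · have h1 (k : ℕ) : succPow y k * f = succPow y k * e := by
      cases k with
      | zero => rw [succPow, hyf, hey]
      | succ k => rw [succPow, mul_assoc, mul_assoc, hyf, hey]
    have := h1 n
    rw [hy, hef, he.eq] at this
    exact hne this.symm
  · have := mul_succPow_of_mul_eq_mul hyf.symm n
    rw [hy, hfe, hef] at this
    exact hne this

theorem mul_ne_right_of_succPow_eq (hef : e * f = e) (hfe : f * e = e) (hne : e ≠ f)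
    (he : IsIdempotentElem e) (hf : IsIdempotentElem f)
    (hE : ∀ g : S, IsIdempotentElem g → g = e ∨ g = f) {x : S} {n : ℕ}
    (hx : succPow x n = e) (u : S) : x * u ≠ f := by
  intro hu
  have hidem : IsIdempotentElem (u * f * x) := by
    calc u * f * x * (u * f * x) = u * f * (x * u) * f * x := by simp only [mul_assoc]
      _ = u * f * x := by rw [hu, mul_assoc u, hf.eq, mul_assoc u, hf.eq]
  have hfx : f * x = x * (u * f * x) := by rw [← mul_assoc, ← mul_assoc, hu, hf.eq]
  obtain ⟨w, hw⟩ : ∃ w, f = x * f * w := by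
    rcases hE _ hidem with h | h <;> rw [h] at hfx
    · refine ⟨e * u, ?_⟩
      rw [mul_assoc, ← mul_assoc f, hfe, ← mul_assoc, ← hfx, mul_assoc, hu, hf.eq]
    · refine ⟨u, ?_⟩
      rw [← hfx, mul_assoc, hu, hf.eq]
  have h := eq_succPow_mul_of_eq_mul hw n
  rw [hx, hef] at h
  apply hne
  rw [← hef, h, ← mul_assoc, he.eq]

theorem mul_ne_left_of_succPow_eq (hef : e * f = e) (hfe : f * e = e) (hne : e ≠ f)
    (he : IsIdempotentElem e) (hf : IsIdempotentElem f)
    (hE : ∀ g : S, IsIdempotentElem g → g = e ∨ g = f) {y : S} {n : ℕ}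
    (hy : succPow y n = e) (u : S) : u * y ≠ f := by
  intro hu
  have hidem : IsIdempotentElem (y * f * u) := by
    calc y * f * u * (y * f * u) = y * f * (u * y) * f * u := by simp only [mul_assoc]
      _ = y * f * u := by rw [hu, mul_assoc y, hf.eq, mul_assoc y, hf.eq]
  have hyf : y * f = y * f * u * y := by rw [mul_assoc, hu, mul_assoc, hf.eq]
  obtain ⟨w, hw⟩ : ∃ w, f = w * f * y := by
    rcases hE _ hidem with h | h <;> rw [h] at hyf
    · refine ⟨u * e, ?_⟩
      rw [mul_assoc u, hef, mul_assoc, ← hyf, ← mul_assoc, hu, hf.eq]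
    · refine ⟨u, ?_⟩
      rw [mul_assoc, ← hyf, ← mul_assoc, hu, hf.eq]
  have h := eq_succPow_mul_of_eq_mul hw n
  rw [hy, mul_assoc, hfe] at h
  apply hne
  rw [← hfe, h, mul_assoc, he.eq]

theorem exists_mul_eq_of_succPow_eq (hf : IsIdempotentElem f) {x : S} {n : ℕ}
    (hx : succPow x n = f) : ∃ u, u * x = f :=
  ⟨succPow x (n + n), by
    conv_rhs => rw [← hf.eq, ← hx, succPow_mul_succPow]
    rfl⟩

theorem succPow_mul_ne_of_succPow_eq (hef : e * f = e) (hfe : f * e = e) (hne : e ≠ f)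
    (he : IsIdempotentElem e) (hf : IsIdempotentElem f)
    (hE : ∀ g : S, IsIdempotentElem g → g = e ∨ g = f) {x y : S} {n m : ℕ}
    (hx : succPow x n = f) (hy : succPow y m = f) (k : ℕ) : succPow (x * y) k ≠ e := by
  intro hxy
  obtain ⟨u, hu⟩ := exists_mul_eq_of_succPow_eq hf hx
  obtain ⟨v, hv⟩ := exists_mul_eq_of_succPow_eq hf hy
  have hfy : f * y = y * f := by rw [← hy, self_mul_succPow]
  apply mul_ne_left_of_succPow_eq hef hfe hne he hf hE hxy (v * u)
  calc v * u * (x * y) = v * (u * x * y) := by simp only [mul_assoc]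
    _ = f := by rw [hu, hfy, ← mul_assoc, hv, hf.eq]

/-- If `e` and `f` are the only idempotents, then sending each element to its idempotent power
is an endomorphism. -/
theorem exists_endomorphism_of_two_idempotents [Finite S] (hne : e ≠ f)
    (he : IsIdempotentElem e) (hf : IsIdempotentElem f)
    (hE : ∀ g : S, IsIdempotentElem g → g = e ∨ g = f) :
    ∃ φ : S → S, (∀ x y, φ (x * y) = φ x * φ y) ∧ φ e = e ∧ φ f = f ∧
      ∀ x, φ x = e ∨ φ x = f := by
  choose N hN using exists_succPow_isIdempotentElem (S := S)
  have hE' (g : S) (hg : IsIdempotentElem g) : g = f ∨ g = e := (hE g hg).symm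
  have hω (x : S) := hE _ (hN x)
  refine ⟨fun x => succPow x (N x), fun x y => ?_, he.succPow_eq _, hf.succPow_eq _, hω⟩
  have hee := he.eq
  have hff := hf.eq
  rcases mul_eq_or_of_forall_isIdempotentElem he hf hE with hef | hef <;>
  rcases mul_eq_or_of_forall_isIdempotentElem hf he hE' with hfe | hfe
  · have h1 := succPow_mul_ne_of_left_zero hef hfe hne he hf hE (x := x) (n := N x)
    have h2 := succPow_mul_ne_of_left_zero hfe hef hne.symm hf he hE' (x := x) (n := N x)
    grind
  · have h1 := fun h => mul_ne_right_of_succPow_eq hef hfe hne he hf hE (x := x) (n := N x) h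
    have h2 := fun h => mul_ne_left_of_succPow_eq hef hfe hne he hf hE (y := y) (n := N y) h
    have h3 := succPow_mul_ne_of_succPow_eq hef hfe hne he hf hE (x := x) (y := y)
      (n := N x) (m := N y)
    obtain ⟨u, hu⟩ := exists_succPow_mul_eq_mul_right x y (N (x * y))
    obtain ⟨v, hv⟩ := exists_succPow_mul_eq_mul_left x y (N (x * y))
    grind
  · have h1 := fun h => mul_ne_right_of_succPow_eq hfe hef hne.symm hf he hE' (x := x) (n := N x) h
    have h2 := fun h => mul_ne_left_of_succPow_eq hfe hef hne.symm hf he hE' (y := y) (n := N y) h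
    have h3 := succPow_mul_ne_of_succPow_eq hfe hef hne.symm hf he hE' (x := x) (y := y)
      (n := N x) (m := N y)
    obtain ⟨u, hu⟩ := exists_succPow_mul_eq_mul_right x y (N (x * y))
    obtain ⟨v, hv⟩ := exists_succPow_mul_eq_mul_left x y (N (x * y))
    grind
  · have h1 := succPow_mul_ne_of_right_zero hef hfe hne he hf hE x (y := y) (n := N y)
    have h2 := succPow_mul_ne_of_right_zero hfe hef hne.symm hf he hE' x (y := y) (n := N y)
    grind

end TwoIdempotents

/-! ### One idempotent -/

section UniqueIdempotent

/-- Elements `x` outside the maximal subgroup at `e` that are a product with at least two factors,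
one of which is `y`. -/
def IsProperFactor (e y x : S) : Prop :=
  e * x ≠ x ∧ ((∃ s, x = y * s) ∨ (∃ s, x = s * y) ∨ ∃ s t, x = s * y * t)

theorem IsProperFactor.trans {e w y x : S} (h : IsProperFactor e w y) (h' : IsProperFactor e y x) :
    IsProperFactor e w x := by
  obtain ⟨-, h⟩ := h
  obtain ⟨hx, h'⟩ := h'
  refine ⟨hx, ?_⟩
  rcases h with ⟨s, rfl⟩ | ⟨s, rfl⟩ | ⟨s, t, rfl⟩ <;>
  rcases h' with ⟨s', rfl⟩ | ⟨s', rfl⟩ | ⟨s', t', rfl⟩ <;>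
  simp only [mul_assoc]
  · exact .inl ⟨_, rfl⟩
  · exact .inr (.inr ⟨s', s, rfl⟩)
  · exact .inr (.inr ⟨s', s * t', rfl⟩)
  · exact .inr (.inr ⟨s, s', rfl⟩)
  · exact .inr (.inl ⟨s' * s, by rw [mul_assoc]⟩)
  · exact .inr (.inr ⟨s' * s, t', by simp only [mul_assoc]⟩)
  · exact .inr (.inr ⟨s, t * s', rfl⟩)
  · exact .inr (.inr ⟨s' * s, t, by simp only [mul_assoc]⟩)
  · exact .inr (.inr ⟨s' * s, t * t', by simp only [mul_assoc]⟩)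

variable [Finite S] {e : S}

theorem exists_succPow_eq (hE : ∀ g : S, IsIdempotentElem g → g = e) (x : S) :
    ∃ n, succPow x n = e :=
  (exists_succPow_isIdempotentElem x).imp fun _ hn => hE _ hn

theorem mul_comm_of_unique_idempotent (he : IsIdempotentElem e)
    (hE : ∀ g : S, IsIdempotentElem g → g = e) (x : S) : e * x = x * e := by
  have h1 : e * x * e = e * x := by
    obtain ⟨n, hn⟩ := exists_succPow_eq hE (e * x)
    have := self_mul_succPow (e * x) n
    rwa [hn, ← mul_assoc, he.eq] at this
  have h2 : e * (x * e) = x * e := by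
    obtain ⟨n, hn⟩ := exists_succPow_eq hE (x * e)
    have := self_mul_succPow (x * e) n
    rw [hn, mul_assoc, he.eq] at this
    exact this.symm
  rw [← h1, mul_assoc, h2]

theorem mul_mul_mul_of_unique_idempotent (he : IsIdempotentElem e)
    (hE : ∀ g : S, IsIdempotentElem g → g = e) (x y : S) : e * x * (e * y) = e * (x * y) := by
  rw [mul_comm_of_unique_idempotent he hE x, mul_assoc, ← mul_assoc e, he.eq, ← mul_assoc,
    ← mul_comm_of_unique_idempotent he hE x, mul_assoc]

/-- The maximal subgroup at the unique idempotent `e` of a finite semigroup. -/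
noncomputable abbrev groupOfUniqueIdempotent (he : IsIdempotentElem e)
    (hE : ∀ g : S, IsIdempotentElem g → g = e) : Group {x : S // e * x = x} :=
  let : Mul {x : S // e * x = x} := ⟨fun x y => ⟨x * y, by rw [← mul_assoc, x.2]⟩⟩
  let : One {x : S // e * x = x} := ⟨⟨e, he⟩⟩
  let : Inv {x : S // e * x = x} :=
    ⟨fun x => ⟨e * (exists_mul_eq_of_succPow_eq he (exists_succPow_eq hE x.1).choose_spec).choose,
      by rw [← mul_assoc, he.eq]⟩⟩
  Group.ofLeftAxioms (fun _ _ _ => Subtype.ext (mul_assoc _ _ _)) (fun x => Subtype.ext x.2)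
    fun x => Subtype.ext <| (mul_assoc _ _ _).trans <| (congrArg (e * ·)
      (exists_mul_eq_of_succPow_eq he (exists_succPow_eq hE x.1).choose_spec).choose_spec).trans he

theorem not_isProperFactor_self (he : IsIdempotentElem e)
    (hE : ∀ g : S, IsIdempotentElem g → g = e) (x : S) : ¬ IsProperFactor e x x := by
  rintro ⟨hx, ⟨s, h⟩ | ⟨s, h⟩ | ⟨s, t, h⟩⟩ <;> apply hx
  · obtain ⟨n, hn⟩ := exists_succPow_eq hE s
    have h1 (k : ℕ) : x = x * succPow s k := by
      induction k with
      | zero => exact h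
      | succ k ih => rw [succPow, ← mul_assoc, ← ih, ← h]
    have := h1 n
    rw [hn] at this
    rw [mul_comm_of_unique_idempotent he hE, ← this]
  · obtain ⟨n, hn⟩ := exists_succPow_eq hE s
    have h1 (k : ℕ) : x = succPow s k * x := by
      induction k with
      | zero => exact h
      | succ k ih => rw [succPow, mul_assoc, ← h, ← ih]
    have := h1 n
    rw [hn] at this
    exact this.symm
  · obtain ⟨n, hn⟩ := exists_succPow_eq hE s
    have := eq_succPow_mul_of_eq_mul h n
    rw [hn, mul_assoc] at this
    rw [this, ← mul_assoc, he.eq]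

theorem wellFounded_isProperFactor (he : IsIdempotentElem e)
    (hE : ∀ g : S, IsIdempotentElem g → g = e) :
    WellFounded (IsProperFactor e) ∧ WellFounded (Function.swap (IsProperFactor e)) := by
  have : IsTrans S (IsProperFactor e) := ⟨fun _ _ _ => IsProperFactor.trans⟩
  have : Std.Irrefl (IsProperFactor e) := ⟨not_isProperFactor_self he hE⟩
  exact ⟨Finite.wellFounded_of_trans_of_irrefl _, Finite.wellFounded_of_trans_of_irrefl _⟩

theorem exists_forall_mul_mem_group (he : IsIdempotentElem e)
    (hE : ∀ g : S, IsIdempotentElem g → g = e) {c : S} (hc : e * c ≠ c) :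
    ∃ z, e * z ≠ z ∧ ∀ s, e * (z * s) = z * s := by
  obtain ⟨z, hz, hmax⟩ := (wellFounded_isProperFactor he hE).2.has_min {x | e * x ≠ x} ⟨c, hc⟩
  exact ⟨z, hz, fun s => by_contra fun h => hmax (z * s) h ⟨h, .inl ⟨s, rfl⟩⟩⟩

theorem factors_notMem_group (he : IsIdempotentElem e)
    (hE : ∀ g : S, IsIdempotentElem g → g = e) {s t : S} (h : e * (s * t) ≠ s * t) :
    e * s ≠ s ∧ e * t ≠ t := by
  refine ⟨fun hs => h (by rw [← mul_assoc, hs]), fun ht => h ?_⟩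
  rw [← mul_assoc, mul_comm_of_unique_idempotent he hE, mul_assoc, ht]

theorem exists_not_mul_of_prop (he : IsIdempotentElem e)
    (hE : ∀ g : S, IsIdempotentElem g → g = e) {P : S → Prop}
    (hP : ∀ s t, P (s * t) → P s ∨ P t) {c : S} (hc : e * c ≠ c) (hPc : P c) :
    ∃ a, e * a ≠ a ∧ P a ∧ ∀ s t, s * t ≠ a := by
  obtain ⟨a, ⟨ha, hPa⟩, hmin⟩ :=
    (wellFounded_isProperFactor he hE).1.has_min {x | e * x ≠ x ∧ P x} ⟨c, hc, hPc⟩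
  refine ⟨a, ha, hPa, ?_⟩
  rintro s t rfl
  obtain ⟨hs, ht⟩ := factors_notMem_group he hE ha
  rcases hP s t hPa with h | h
  · exact hmin s ⟨hs, h⟩ ⟨ha, .inl ⟨t, rfl⟩⟩
  · exact hmin t ⟨ht, h⟩ ⟨ha, .inr (.inl ⟨s, rfl⟩)⟩

open Classical in
theorem update_mul_of_not_mul (he : IsIdempotentElem e)
    (hE : ∀ g : S, IsIdempotentElem g → g = e) {a z : S} (ha : ∀ s t, s * t ≠ a)
    (hz : ∀ s, e * (z * s) = z * s) {χ : S → S} (hχ : ∀ x y, χ (x * y) = χ x * χ y)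
    (hχe : ∀ x, e * χ x = χ x) (hχa : χ a = e * z) (x y : S) :
    Function.update χ a z (x * y) = Function.update χ a z x * Function.update χ a z y := by
  have h1 (x : S) : e * Function.update χ a z x = χ x := by
    rcases eq_or_ne x a with rfl | h
    · simp [hχa]
    · simp [h, hχe]
  have h2 : e * (Function.update χ a z x * Function.update χ a z y) =
      Function.update χ a z x * Function.update χ a z y := by
    rcases eq_or_ne x a with rfl | h
    · simp [hz]
    · simp [h, ← mul_assoc, hχe]
  rw [Function.update_of_ne (ha x y), hχ, ← h1 x, ← h1 y,
    mul_mul_mul_of_unique_idempotent he hE, h2]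

theorem eq_or_exists_eq_succPow (he : IsIdempotentElem e)
    (hE : ∀ g : S, IsIdempotentElem g → g = e) (hzero : ∀ x, e * x = e) {a : S}
    (ha : ∀ b, b ≠ a → e * b ≠ b → ∃ s t, s * t = b) (x : S) :
    x = e ∨ ∃ n, x = succPow a n := by
  induction x using (wellFounded_isProperFactor he hE).1.induction with
  | _ x ih =>
    by_cases hx : e * x = x
    · exact .inl (hx.symm.trans (hzero x))
    by_cases hxa : x = a
    · exact .inr ⟨0, hxa⟩
    obtain ⟨s, t, rfl⟩ := ha x hxa hx
    obtain ⟨hs, ht⟩ := factors_notMem_group he hE hx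
    rw [hzero] at hs ht
    rcases ih s ⟨hx, .inl ⟨t, rfl⟩⟩ with rfl | ⟨m, rfl⟩
    · exact absurd rfl hs
    rcases ih t ⟨hx, .inr (.inl ⟨_, rfl⟩)⟩ with rfl | ⟨n, rfl⟩
    · exact absurd rfl ht
    exact .inr ⟨_, succPow_mul_succPow a m n⟩

open Classical in
theorem four_le_card_of_nilpotent (h : 4 ≤ Nat.card S) (he : IsIdempotentElem e)
    (hE : ∀ g : S, IsIdempotentElem g → g = e) (hzero : ∀ x, e * x = e) :
    4 ≤ Nat.card {f : S → S // ∀ x y : S, f (x * y) = f x * f y} := by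
  obtain ⟨c, hc, -⟩ := exists_ne_of_four_le_card h e e e
  obtain ⟨z, hz, hzS⟩ := exists_forall_mul_mem_group he hE (c := c) (by rw [hzero]; exact hc.symm)
  obtain ⟨a, ha, -, haS⟩ := exists_not_mul_of_prop he hE (P := fun _ => True)
    (fun _ _ _ => .inl trivial) (c := c) (by rw [hzero]; exact hc.symm) trivial
  have hhom {b : S} (hb : ∀ s t, s * t ≠ b) :=
    update_mul_of_not_mul he hE hb hzS (χ := fun _ => e) (fun _ _ => he.eq.symm)
      (fun _ => he) (hzero z).symm
  rw [hzero] at hz ha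
  obtain ⟨d, hda, hde, -⟩ := exists_ne_of_four_le_card h a e e
  have hid : id ≠ Function.update (fun _ => e) a z := fun H => by
    have := congrFun H d
    simp [hda, hde] at this
  have hconst (b : S) : (fun _ => e) ≠ Function.update (fun _ => e) b z := fun H => by
    have := congrFun H b
    simp [hz] at this
  by_cases hb : ∃ b, b ≠ a ∧ e * b ≠ b ∧ ∀ s t, s * t ≠ b
  · obtain ⟨b, hba, -, hb⟩ := hb
    obtain ⟨d', hdb, hde', -⟩ := exists_ne_of_four_le_card h b e e
    refine four_le_card_endomorphisms_of_ne (f₁ := fun _ => e) (f₂ := id)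
      (fun _ _ => he.eq.symm) (fun _ _ => rfl) (hhom haS) (hhom hb)
      (fun H => hc (congrFun H c).symm) (hconst a) (hconst b) hid (fun H => ?_) (fun H => ?_)
    · have := congrFun H d'
      simp [hdb, hde'] at this
    · have := congrFun H a
      simp [hba.symm, hz.symm] at this
  · push Not at hb
    have hgen := eq_or_exists_eq_succPow he hE hzero hb
    have hcomm (x y : S) : x * y = y * x := by
      rcases hgen x with rfl | ⟨m, rfl⟩
      · exact mul_comm_of_unique_idempotent he hE y
      rcases hgen y with rfl | ⟨n, rfl⟩
      · exact (mul_comm_of_unique_idempotent he hE _).symm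
      exact succPow_mul_comm a m n
    have hcube : a * a * a ≠ e := fun H => by
      obtain ⟨x, hxe, hxa, hxa2⟩ := exists_ne_of_four_le_card h e a (a * a)
      rcases hgen x with rfl | ⟨n, rfl⟩
      · exact hxe rfl
      have hpow (k : ℕ) : succPow a (k + 2) = e := by
        induction k with
        | zero => exact H
        | succ k ih => rw [succPow, ih, hzero]
      match n with
      | 0 => exact hxa rfl
      | 1 => exact hxa2 rfl
      | n + 2 => exact hxe (hpow n)
    refine four_le_card_endomorphisms_of_ne (f₁ := fun _ => e) (f₂ := id) (f₄ := fun x => x * x)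
      (fun _ _ => he.eq.symm) (fun _ _ => rfl) (hhom haS) (fun x y => ?_)
      (fun H => hc (congrFun H c).symm) (hconst a) (fun H => hcube ?_) hid
      (fun H => haS a a (congrFun H a).symm) (fun H => hcube ?_)
    · calc x * y * (x * y) = x * (y * x) * y := by simp only [mul_assoc]
        _ = x * x * (y * y) := by rw [hcomm y x]; simp only [mul_assoc]
    · rw [← congrFun H a, hzero]
    · have := congrFun H a
      simp only [Function.update_self] at this
      rw [← this, ← hzS, hzero]

open Classical in
theorem four_le_card_of_group_of_order_two (h : 4 ≤ Nat.card S) (he : IsIdempotentElem e)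
    (hE : ∀ g : S, IsIdempotentElem g → g = e) {c g : S} (hc : e * c ≠ c) (hge : g ≠ e)
    (heg : e * g = g) (hr : ∀ x, e * x = e ∨ e * x = g) :
    4 ≤ Nat.card {f : S → S // ∀ x y : S, f (x * y) = f x * f y} := by
  have hrhom (x y : S) := (mul_mul_mul_of_unique_idempotent he hE x y).symm
  obtain ⟨z, hz, hzS⟩ := exists_forall_mul_mem_group he hE hc
  obtain ⟨a, χ, haS, hχ, hχe, hχa⟩ : ∃ (a : S) (χ : S → S), (∀ s t, s * t ≠ a) ∧
      (∀ x y, χ (x * y) = χ x * χ y) ∧ (∀ x, e * χ x = χ x) ∧ χ a = e * z := by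
    rcases hr z with hze | hzg
    · obtain ⟨a, -, -, haS⟩ := exists_not_mul_of_prop he hE (P := fun _ => True)
        (fun _ _ _ => .inl trivial) hc trivial
      exact ⟨a, fun _ => e, haS, fun _ _ => he.eq.symm, fun _ => he, hze.symm⟩
    · obtain ⟨a, -, hag, haS⟩ := exists_not_mul_of_prop he hE (P := fun x => e * x = g)
        (fun s t hst => by
          by_contra! hne
          rw [hrhom, (hr s).resolve_right hne.1, (hr t).resolve_right hne.2, he.eq] at hst
          exact hge hst.symm) hz hzg
      exact ⟨a, (e * ·), haS, hrhom, fun x => by rw [← mul_assoc, he.eq], hag.trans hzg.symm⟩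
  obtain ⟨d, hde, hdg, hda⟩ := exists_ne_of_four_le_card h e g a
  refine four_le_card_endomorphisms_of_ne (f₁ := fun _ => e) (f₂ := id) (f₃ := (e * ·))
    (fun _ _ => he.eq.symm) (fun _ _ => rfl) hrhom
    (update_mul_of_not_mul he hE haS hzS hχ hχe hχa)
    (fun H => hge (congrFun H g).symm) (fun H => hge ?_) (fun H => hz ?_)
    (fun H => hc (congrFun H c).symm) (fun H => ?_) (fun H => hz ?_)
  · rw [← heg]; exact (congrFun H g).symm
  · have := congrFun H a
    simp only [Function.update_self] at this
    rw [← this, he.eq]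
  · have := congrFun H d
    rw [id, Function.update_of_ne hda] at this
    have h1 := hχe d
    rw [← this] at h1
    rcases hr d with h2 | h2 <;> rw [h1] at h2 <;> contradiction
  · have := congrFun H a
    simp only [Function.update_self] at this
    rw [← this, ← mul_assoc, he.eq]

theorem four_le_card_of_unique_idempotent (h : 4 ≤ Nat.card S) (he : IsIdempotentElem e)
    (hE : ∀ g : S, IsIdempotentElem g → g = e) :
    4 ≤ Nat.card {f : S → S // ∀ x y : S, f (x * y) = f x * f y} := by
  let := groupOfUniqueIdempotent he hE
  let extend (φ : {x : S // e * x = x} →* {x : S // e * x = x}) :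
      {f : S → S // ∀ x y : S, f (x * y) = f x * f y} :=
    ⟨fun x => φ ⟨e * x, by rw [← mul_assoc, he.eq]⟩, fun x y => congrArg Subtype.val <|
      (congrArg φ (Subtype.ext (mul_mul_mul_of_unique_idempotent he hE x y).symm)).trans
        (map_mul φ ⟨e * x, by rw [← mul_assoc, he.eq]⟩ ⟨e * y, by rw [← mul_assoc, he.eq]⟩)⟩
  have hextend : Function.Injective extend := fun φ ψ H => by
    ext ⟨x, hx⟩
    have := congrFun (congrArg Subtype.val H) x
    simpa only [extend, hx] using this
  have hcard := min_card_four_le_card_end {x : S // e * x = x}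
  by_cases hS : ∀ x, e * x = x
  · rw [Nat.card_congr (Equiv.subtypeUnivEquiv hS), min_eq_right h] at hcard
    exact hcard.trans (Nat.card_le_card_of_injective _ hextend)
  push Not at hS
  obtain ⟨c, hc⟩ := hS
  by_cases hzero : ∀ x, e * x = e
  · exact four_le_card_of_nilpotent h he hE hzero
  push Not at hzero
  obtain ⟨g, hg⟩ := hzero
  have heg : e * (e * g) = e * g := by rw [← mul_assoc, he.eq]
  by_cases hr : ∀ x, e * x = e ∨ e * x = e * g
  · exact four_le_card_of_group_of_order_two h he hE hc hg heg hr
  push Not at hr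
  obtain ⟨k, hke, hkg⟩ := hr
  have h3 : 2 < Nat.card {x : S // e * x = x} := by
    have := Fintype.ofFinite {x : S // e * x = x}
    rw [Nat.card_eq_fintype_card, Fintype.two_lt_card_iff]
    exact ⟨⟨e, he⟩, ⟨e * g, heg⟩, ⟨e * k, by rw [← mul_assoc, he.eq]⟩,
      fun H => hg (congrArg Subtype.val H).symm, fun H => hke (congrArg Subtype.val H).symm,
      fun H => hkg (congrArg Subtype.val H).symm⟩
  have : Finite ({x : S // e * x = x} →* {x : S // e * x = x}) := DFunLike.finite _
  have hinj : Function.Injective fun o : Option ({x : S // e * x = x} →* {x : S // e * x = x}) =>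
      o.elim ⟨id, fun _ _ => rfl⟩ extend := by
    rw [Option.injective_iff]
    refine ⟨hextend, ?_⟩
    rintro ⟨φ, hφ⟩
    apply hc
    have := congrFun (congrArg Subtype.val hφ) c
    simp only [Function.comp, Option.elim, extend, id] at this
    rw [← this]
    exact (φ _).2
  have := Nat.card_le_card_of_injective _ hinj
  rw [Finite.card_option] at this
  omega

end UniqueIdempotent

end Semigroup

/-- **Kublanovsky.** Every finite semigroup with at least four elements has at
least four endomorphisms. -/
theorem four_le_card_endomorphisms {S : Type*} [Semigroup S] [Finite S]
    (h : 4 ≤ Nat.card S) :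
    4 ≤ Nat.card {f : S → S // ∀ x y : S, f (x * y) = f x * f y} := by
  have : Nonempty S := Finite.card_pos_iff.mp (by omega)
  obtain ⟨n, he⟩ := exists_succPow_isIdempotentElem (Classical.arbitrary S)
  generalize succPow (Classical.arbitrary S) n = e at he
  by_cases hE : ∀ g : S, IsIdempotentElem g → g = e
  · exact four_le_card_of_unique_idempotent h he hE
  push Not at hE
  obtain ⟨f, hf, hfe⟩ := hE
  have hconst {a : S} (ha : IsIdempotentElem a) (x y : S) :
      (fun _ : S => a) (x * y) = (fun _ : S => a) x * (fun _ : S => a) y := ha.eq.symm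
  have hne {a b : S} (hab : a ≠ b) : (fun _ : S => a) ≠ fun _ => b := fun H => hab (congrFun H e)
  by_cases hE : ∀ g : S, IsIdempotentElem g → g = e ∨ g = f
  · obtain ⟨φ, hφ, hφe, hφf, hφr⟩ := exists_endomorphism_of_two_idempotents hfe.symm he hf hE
    obtain ⟨d, hde, hdf, -⟩ := exists_ne_of_four_le_card h e f f
    refine four_le_card_endomorphisms_of_ne (f₃ := id) (hconst he) (hconst hf) (fun _ _ => rfl) hφ
      (hne hfe.symm) (fun H => hde (congrFun H d).symm) (fun H => ?_)
      (fun H => hdf (congrFun H d).symm) (fun H => ?_) (fun H => ?_)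
    · exact hfe (hφf.symm.trans (congrFun H f).symm)
    · exact hfe ((congrFun H e).trans hφe)
    · rcases hφr d with h' | h' <;> rw [← H] at h' <;> contradiction
  push Not at hE
  obtain ⟨g, hg, hge, hgf⟩ := hE
  exact four_le_card_endomorphisms_of_ne (f₄ := id) (hconst he) (hconst hf) (hconst hg)
    (fun _ _ => rfl) (hne hfe.symm) (hne hge.symm) (fun H => hfe (congrFun H f).symm)
    (hne hgf.symm) (fun H => hfe (congrFun H e)) (fun H => hge (congrFun H e))
end

section
/- There exist infinitely many pairwise non-isomorphic finite semigroups with exactly four endomorphisms; in particular, for every natural number n there exists a finite semigroup with at least n elements whose set of endomorphisms has exactly four elements. -/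
/-- The underlying set of a finite semigroup with zero `o`, one nonzero idempotent `e`, and three
families of nilpotent elements indexed by `ZMod m`. -/
inductive FourEnd (m : ℕ) : Type
  | o : FourEnd m
  | e : FourEnd m
  | x (i : ZMod m) : FourEnd m
  | y (i : ZMod m) : FourEnd m
  | z (i : ZMod m) : FourEnd m

namespace FourEnd

variable {m : ℕ}

/-- The only nonzero products are `e * e = e`, `e * x i = x i`, `x i * e = z i`, `e * y i = z i`,
`y i * e = y i`, `e * z i = z i * e = z i`, `x i * y i = z (i + 1)` and `x 0 * y 1 = z 0`. -/
def mul : FourEnd m → FourEnd m → FourEnd m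
  | e, e => e
  | e, x i => x i
  | x i, e => z i
  | e, y i => z i
  | y i, e => y i
  | e, z i => z i
  | z i, e => z i
  | x i, y j => if j = i then z (i + 1) else if i = 0 ∧ j = 1 then z 0 else o
  | _, _ => o

instance : Semigroup (FourEnd m) where
  mul := mul
  mul_assoc a b c := by
    change mul (mul a b) c = mul a (mul b c)
    cases a <;> cases b <;> cases c <;> simp only [mul] <;> split_ifs <;> rfl

theorem mul_def (a b : FourEnd m) : a * b = mul a b := rfl

instance [NeZero m] : Finite (FourEnd m) := by
  refine Finite.of_surjective
    (fun t : Bool ⊕ ZMod m ⊕ ZMod m ⊕ ZMod m =>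
      t.elim (fun b => cond b e o) (Sum.elim x (Sum.elim y z))) ?_
  rintro (_ | _ | i | i | i)
  · exact ⟨.inl false, rfl⟩
  · exact ⟨.inl true, rfl⟩
  · exact ⟨.inr (.inl i), rfl⟩
  · exact ⟨.inr (.inr (.inl i)), rfl⟩
  · exact ⟨.inr (.inr (.inr i)), rfl⟩

theorem le_card [NeZero m] : m ≤ Nat.card (FourEnd m) := by
  simpa using Nat.card_le_card_of_injective (z : ZMod m → FourEnd m) fun _ _ h => by simpa using h

theorem eq_o_or_e_of_mul_self {a : FourEnd m} (h : a * a = a) : a = o ∨ a = e := by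
  cases a <;> simp_all [mul_def, mul]

theorem eq_e_of_mul_e {a : FourEnd m} (h : a * e = e) : a = e := by
  cases a <;> simp_all [mul_def, mul]

theorem eq_o_of_mul_e {a : FourEnd m} (h : a * e = o) : a = o := by
  cases a <;> simp_all [mul_def, mul]

theorem eq_o_of_e_mul {a : FourEnd m} (h : e * a = o) : a = o := by
  cases a <;> simp_all [mul_def, mul]

theorem e_mul_x (i : ZMod m) : e * x i = x i := rfl
theorem x_mul_e (i : ZMod m) : x i * e = z i := rfl
theorem e_mul_y (i : ZMod m) : e * y i = z i := rfl
theorem y_mul_e (i : ZMod m) : y i * e = y i := rfl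
theorem x_mul_y (i : ZMod m) : x i * y i = z (i + 1) := by simp [mul_def, mul]
theorem x_zero_mul_y_one [Nontrivial (ZMod m)] : (x 0 * y 1 : FourEnd m) = z 0 := by
  simp [mul_def, mul]

theorem eq_zero_of_x_mul_y_add_one [Nontrivial (ZMod m)] {c k : ZMod m}
    (h : x c * y (c + 1) = z k) : c = 0 := by
  by_contra hc
  simp [mul_def, mul, hc] at h

/-- If a product `a * b ≠ o` of nilpotent elements has `a` fixed by `e` on the left and `b` fixed
by `e` on the right, then `a` is some `x i` and `b` is some `y j`. -/
theorem exists_x_y_of_mul_ne_o {a b : FourEnd m} (ha : e * a = a) (hb : b * e = b)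
    (ha2 : a * a = o) (hb2 : b * b = o) (hab : a * b ≠ o) :
    (∃ i, a = x i) ∧ ∃ j, b = y j := by
  cases a <;> cases b <;> simp_all [mul_def, mul]

/-- The endomorphism fixing `e` and sending every other element to `o`. -/
def indicator : FourEnd m → FourEnd m
  | e => e
  | _ => o

theorem indicator_mul (a b : FourEnd m) : indicator (a * b) = indicator a * indicator b := by
  cases a <;> cases b <;> simp only [mul_def, mul, indicator]; split_ifs <;> rfl

theorem endomorphism_cases [NeZero m] [Nontrivial (ZMod m)] {f : FourEnd m → FourEnd m}
    (hf : ∀ a b, f (a * b) = f a * f b) :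
    f = (fun _ => o) ∨ f = (fun _ => e) ∨ f = indicator ∨ f = id := by
  have o_mul (a : FourEnd m) : o * a = o := by cases a <;> rfl
  have mul_o (a : FourEnd m) : a * o = o := by cases a <;> rfl
  rcases eq_o_or_e_of_mul_self (hf e e).symm with he | he
  · left
    funext a
    have hl (b : FourEnd m) : f (e * b) = o := by rw [hf, he, o_mul]
    have hr (b : FourEnd m) : f (b * e) = o := by rw [hf, he, mul_o]
    cases a
    · exact hl o
    · exact he
    · exact hl (x _)
    · exact hr (y _)
    · exact hl (z _)
  rcases eq_o_or_e_of_mul_self (hf o o).symm with ho | ho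
  swap
  · right; left
    funext a
    apply eq_e_of_mul_e
    rw [← ho, ← hf, mul_o]
  right; right
  have hxe (i) : f (x i) * e = f (z i) := by rw [← he, ← hf, x_mul_e]
  have hey (i) : e * f (y i) = f (z i) := by rw [← he, ← hf, e_mul_y]
  have hxy (i) : f (x i) * f (y i) = f (z (i + 1)) := by rw [← hf, x_mul_y]
  by_cases hz : ∃ i, f (z i) = o
  · left
    obtain ⟨i, hi⟩ := hz
    have hx {j} (hj : f (z j) = o) : f (x j) = o := eq_o_of_mul_e ((hxe j).trans hj)
    have hy {j} (hj : f (z j) = o) : f (y j) = o := eq_o_of_e_mul ((hey j).trans hj)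
    have hk (k : ℕ) : f (z (i + k)) = o := by
      induction k with
      | zero => simpa using hi
      | succ k ih => rw [Nat.cast_succ, ← add_assoc, ← hxy, hx ih, o_mul]
    have hall (j) : f (z j) = o := by
      simpa using hk (j - i).val
    funext a
    cases a
    · exact ho
    · exact he
    · exact hx (hall _)
    · exact hy (hall _)
    · exact hall _
  · right
    push Not at hz
    have hφ (i) : ∃ k, f (x i) = x k ∧ f (y i) = y k ∧ f (z i) = z k := by
      obtain ⟨⟨k, hk⟩, l, hl⟩ := exists_x_y_of_mul_ne_o (a := f (x i)) (b := f (y i))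
        (by rw [← he, ← hf, e_mul_x]) (by rw [← he, ← hf, y_mul_e])
        (by rw [← hf, ← ho]; rfl) (by rw [← hf, ← ho]; rfl) (by rw [hxy]; exact hz _)
      have h1 := hxe i
      have h2 := hey i
      rw [hk, x_mul_e] at h1
      rw [hl, e_mul_y, ← h1, z.injEq] at h2
      exact ⟨k, hk, h2 ▸ hl, h1.symm⟩
    choose φ hφx hφy hφz using hφ
    have hsucc (i) : φ (i + 1) = φ i + 1 := by
      have h := hxy i
      rw [hφx, hφy, hφz, x_mul_y, z.injEq] at h
      exact h.symm
    have hzero : φ 0 = 0 := by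
      have h := hf (x 0) (y 1)
      rw [x_zero_mul_y_one, hφx, hφy, hφz, ← zero_add (1 : ZMod m), hsucc] at h
      exact eq_zero_of_x_mul_y_add_one h.symm
    have hnat (k : ℕ) : φ k = k := by
      induction k with
      | zero => simpa using hzero
      | succ k ih => rw [Nat.cast_succ, hsucc, ih]
    have hid (i) : φ i = i := by
      simpa using hnat i.val
    funext a
    cases a
    · exact ho
    · exact he
    · rw [hφx, hid]; rfl
    · rw [hφy, hid]; rfl
    · rw [hφz, hid]; rfl

theorem card_endomorphisms [NeZero m] [Nontrivial (ZMod m)] :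
    Nat.card {f : FourEnd m → FourEnd m // ∀ a b, f (a * b) = f a * f b} = 4 := by
  have hset : {f : FourEnd m → FourEnd m | ∀ a b, f (a * b) = f a * f b} =
      {fun _ => o, fun _ => e, indicator, id} := by
    ext f
    simp only [Set.mem_ofPred_eq, Set.mem_insert_iff, Set.mem_singleton_iff]
    refine ⟨endomorphism_cases, ?_⟩
    rintro (rfl | rfl | rfl | rfl)
    · exact fun _ _ => rfl
    · exact fun _ _ => rfl
    · exact indicator_mul
    · exact fun _ _ => rfl
  have h12 : (fun _ => o : FourEnd m → FourEnd m) ≠ fun _ => e :=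
    fun h => nomatch congrFun h o
  have h13 : (fun _ => o : FourEnd m → FourEnd m) ≠ indicator :=
    fun h => nomatch congrFun h e
  have h14 : (fun _ => o : FourEnd m → FourEnd m) ≠ id :=
    fun h => nomatch congrFun h e
  have h23 : (fun _ => e : FourEnd m → FourEnd m) ≠ indicator :=
    fun h => nomatch congrFun h o
  have h24 : (fun _ => e : FourEnd m → FourEnd m) ≠ id :=
    fun h => nomatch congrFun h o
  have h34 : (indicator : FourEnd m → FourEnd m) ≠ id :=
    fun h => nomatch congrFun h (x 0)
  change Nat.card {f : FourEnd m → FourEnd m | ∀ a b, f (a * b) = f a * f b} = 4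
  rw [hset, Nat.card_coe_set_eq, Set.ncard_insert_of_notMem (by simp [h12, h13, h14]),
    Set.ncard_insert_of_notMem (by simp [h23, h24]), Set.ncard_pair h34]

end FourEnd

/-- **Kublanovsky.** There exist infinitely many pairwise non-isomorphic finite
semigroups with exactly four endomorphisms: for every `n` there is a finite
semigroup with at least `n` elements having exactly four endomorphisms. -/
theorem arbitrarily_large_finite_semigroups_with_four_endomorphisms (n : ℕ) :
    ∃ (S : Type) (_ : Semigroup S), Finite S ∧ n ≤ Nat.card S ∧
      Nat.card {f : S → S // ∀ x y : S, f (x * y) = f x * f y} = 4 := by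
  have : Fact (1 < n + 2) := ⟨by omega⟩
  exact ⟨FourEnd (n + 2), inferInstance, inferInstance,
    le_trans (by omega) FourEnd.le_card, FourEnd.card_endomorphisms⟩
end

section
/- Every finite commutative semigroup with more than four elements has at least five endomorphisms. -/
namespace CommSemigroupEndo

/-- A finite commutative group has at least as many endomorphisms as elements. -/
lemma card_le_card_monoidHom_self (G : Type*) [CommGroup G] [Finite G] :
    Nat.card G ≤ Nat.card (G →* G) := by
  obtain ⟨g, hg⟩ := Monoid.exists_orderOf_eq_exponent (G := G) Monoid.ExponentExists.of_finite
  let M := Subgroup.zpowers g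
  have : HasEnoughRootsOfUnity M (Monoid.exponent G) :=
    { prim := by
        refine ⟨⟨g, Subgroup.mem_zpowers g⟩, ?_⟩
        rw [← hg, ← Subgroup.orderOf_mk g (Subgroup.mem_zpowers g)]
        exact IsPrimitiveRoot.orderOf _
      cyc := by
        have : IsCyclic Mˣ := isCyclic_of_surjective toUnits toUnits.surjective
        infer_instance }
  rw [← CommGroup.card_monoidHom_of_hasEnoughRootsOfUnity G M]
  have : Finite (G →* G) := .of_injective _ DFunLike.coe_injective
  refine Nat.card_le_card_of_injective
    (fun φ : G →* Mˣ => (M.subtype.comp (Units.coeHom M)).comp φ) fun φ ψ h => ?_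
  ext x
  exact DFunLike.congr_fun h x

/-- The property of being an endomorphism of a semigroup. -/
def IsEndo {S : Type*} [Mul S] (f : S → S) : Prop := ∀ x y : S, f (x * y) = f x * f y

lemma exists_notMem_of_card_lt {S : Type*} [Finite S] {m n : ℕ} (h : n < Nat.card S) (s : Finset S)
    (hs : s.card ≤ m) (hmn : m ≤ n := by omega) : ∃ x, x ∉ s := by
  by_contra! hcon
  have := Set.ncard_le_ncard (fun x _ => hcon x : (Set.univ : Set S) ⊆ s)
  rw [Set.ncard_univ, Set.ncard_coe_finset] at this
  omega

lemma exists_ne_ne_of_four_lt_card {S : Type*} [Finite S] (h : 4 < Nat.card S) (a b : S) :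
    ∃ x, x ≠ a ∧ x ≠ b := by
  classical
  simpa using exists_notMem_of_card_lt h {a, b} Finset.card_le_two

section

variable {S : Type*} [CommSemigroup S]

lemma card_le_card_endo_of_inverses [Finite S] (u : S) (hu : ∀ x : S, u * x = x)
    (hinv : ∀ x : S, ∃ y, y * x = u) :
    Nat.card S ≤ Nat.card {f : S → S // IsEndo f} := by
  choose inv hinv using hinv
  let _ : CommGroup S :=
    { one := u
      one_mul := hu
      mul_one := fun x => (mul_comm x u).trans (hu x)
      inv := inv
      inv_mul_cancel := hinv
      mul_comm := mul_comm }
  refine (card_le_card_monoidHom_self S).trans ?_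
  exact Nat.card_le_card_of_injective
    (fun φ : S →* S => (⟨φ, map_mul φ⟩ : {f : S → S // IsEndo f}))
    fun φ ψ h => DFunLike.coe_injective (congrArg Subtype.val h)

/-- A family of endomorphisms satisfying `Q` together with a list of endomorphisms
violating `Q`. -/
lemma card_add_length_le [Finite S] {α : Type*} [Finite α] (F : α → S → S)
    (hF : Function.Injective F) (hFe : ∀ i, IsEndo (F i)) (Q : (S → S) → Prop)
    (hQ : ∀ i, Q (F i)) (l : List (S → S)) (hl : l.Nodup)
    (h : ∀ f ∈ l, IsEndo f ∧ ¬ Q f) :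
    Nat.card α + l.length ≤ Nat.card {f : S → S // IsEndo f} := by
  have hc : Nat.card α + l.length = Nat.card (α ⊕ Fin l.length) := by simp
  rw [hc]
  refine Nat.card_le_card_of_injective
    (Sum.elim (fun i => ⟨F i, hFe i⟩) (fun j => ⟨l.get j, (h _ (l.get_mem j)).1⟩)) ?_
  rintro (i | i) (j | j) hij
  · exact congrArg Sum.inl (hF (congrArg Subtype.val hij))
  · have e : F i = l.get j := congrArg Subtype.val hij
    exact absurd (e ▸ hQ i) (h _ (l.get_mem j)).2
  · have e : l.get i = F j := congrArg Subtype.val hij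
    exact absurd (e ▸ hQ j) (h _ (l.get_mem i)).2
  · exact congrArg Sum.inr (List.nodup_iff_injective_get.1 hl (congrArg Subtype.val hij))

/-- Changing an endomorphism at an element that is not a product. -/
lemma IsEndo.update [DecidableEq S] {h : S → S} (hh : IsEndo h) {a b : S}
    (ha : ∀ x y, a ≠ x * y) (hb : b * b = h (a * a))
    (hy : ∀ y, y ≠ a → b * h y = h (a * y)) : IsEndo (Function.update h a b) := by
  intro x y
  rw [Function.update_of_ne (ha x y).symm]
  by_cases hx : x = a <;> by_cases hy' : y = a
  · subst hx; subst hy'; simp [hb]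
  · subst hx; simp [Function.update_of_ne hy', hy y hy']
  · subst hy'; simp [Function.update_of_ne hx, mul_comm x y, ← hy x hx, mul_comm b]
  · simp [Function.update_of_ne hx, Function.update_of_ne hy', hh x y]

/-- `spow x n` is the product of `n + 1` copies of `x`. -/
def spow (x : S) : ℕ → S
  | 0 => x
  | n + 1 => spow x n * x

lemma spow_mul_spow (x : S) (m n : ℕ) : spow x m * spow x n = spow x (m + n + 1) := by
  induction n with
  | zero => rfl
  | succ n ih => rw [spow, ← mul_assoc, ih, ← spow, Nat.add_assoc m n 1]

lemma mul_spow_of_le {e x : S} {m n : ℕ} (hmn : m ≤ n) (h : e * spow x m = spow x m) :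
    e * spow x n = spow x n := by
  induction n, hmn using Nat.le_induction with
  | base => exact h
  | succ n _ ih => rw [spow, ← mul_assoc, ih]

lemma isEndo_spow (n : ℕ) : IsEndo (fun x : S => spow x n) := by
  intro x y
  induction n with
  | zero => rfl
  | succ n ih => simp only [spow] at ih ⊢; rw [ih, mul_mul_mul_comm]

lemma isEndo_mul_left {e : S} (he : e * e = e) : IsEndo (fun x => e * x) := by
  intro x y
  simp only
  rw [mul_mul_mul_comm, he]

lemma isEndo_const {e : S} (he : e * e = e) : IsEndo (fun _ : S => e) := fun _ _ => he.symm

lemma isEndo_sq : IsEndo (fun x : S => x * x) := fun x y => mul_mul_mul_comm x y x y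

lemma exists_spow_idempotent (S : Type*) [CommSemigroup S] [Finite S] :
    ∃ N, 1 ≤ N ∧ ∀ x : S, spow x N * spow x N = spow x N := by
  obtain ⟨m, n, hmn, h⟩ : ∃ m n, m < n ∧ ∀ x : S, spow x m = spow x n := by
    obtain ⟨m, n, hmn, h⟩ := Finite.exists_ne_map_eq_of_infinite (fun n (x : S) => spow x n)
    rcases hmn.lt_or_gt with h' | h'
    · exact ⟨m, n, h', congrFun h⟩
    · exact ⟨n, m, h', fun x => (congrFun h x).symm⟩
  obtain ⟨d, rfl⟩ := Nat.exists_eq_add_of_lt hmn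
  have step : ∀ (x : S) k, m ≤ k → spow x (k + (d + 1)) = spow x k := by
    intro x k hk
    induction k, hk using Nat.le_induction with
    | base => exact (h x).symm
    | succ k _ ih => rw [show k + 1 + (d + 1) = k + (d + 1) + 1 by ring, spow, ih, spow]
  have steps : ∀ (x : S) k j, m ≤ k → spow x (k + j * (d + 1)) = spow x k := by
    intro x k j hk
    induction j with
    | zero => simp
    | succ j ih =>
      rw [Nat.succ_mul, ← add_assoc, step x _ (by omega), ih]
  obtain ⟨N, hN⟩ : ∃ N, N + 1 = (m + 2) * (d + 1) := ⟨(m + 2) * (d + 1) - 1, by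
    have : 0 < (m + 2) * (d + 1) := by positivity
    omega⟩
  have hle : m + 2 ≤ (m + 2) * (d + 1) := Nat.le_mul_of_pos_right _ (by omega)
  refine ⟨N, by omega, fun x => ?_⟩
  rw [spow_mul_spow, add_assoc, hN, steps x N _ (by omega)]

/-- If multiplying by elements of a subsemigroup `T` fixes no element of `P`, then some
element of `P` is not a multiple of an element of `P` by an element of `T`. -/
lemma exists_not_multiple [Finite S] (T P : Set S) (hT : ∀ s ∈ T, ∀ t ∈ T, s * t ∈ T)
    (hP : P.Nonempty) (hirr : ∀ x ∈ P, ∀ t ∈ T, x ≠ x * t) :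
    ∃ a ∈ P, ∀ y ∈ P, ∀ t ∈ T, a ≠ y * t := by
  let r : P → P → Prop := fun y x => ∃ t ∈ T, (x : S) = y * t
  have : IsTrans P r := ⟨by
    rintro x y z ⟨s, hs, h⟩ ⟨t, ht, h'⟩
    exact ⟨s * t, hT s hs t ht, by rw [h', h, mul_assoc]⟩⟩
  have : Std.Irrefl r := ⟨by
    rintro x ⟨t, ht, h⟩
    exact hirr x x.2 t ht h⟩
  obtain ⟨p, hp⟩ := hP
  obtain ⟨a, -, ha⟩ := (Finite.wellFounded_of_trans_of_irrefl r).has_min Set.univ ⟨⟨p, hp⟩, trivial⟩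
  exact ⟨a, a.2, fun y hy t ht h => ha ⟨y, hy⟩ trivial ⟨t, ht, h⟩⟩

/-- Idempotents give constant endomorphisms, to which any list of nonconstant endomorphisms
can be added. -/
lemma card_idempotents_add_length_le [Finite S] [Nonempty S] (l : List (S → S)) (hl : l.Nodup)
    (h : ∀ f ∈ l, IsEndo f ∧ ∃ x y, f x ≠ f y) :
    Nat.card {e : S // e * e = e} + l.length ≤ Nat.card {f : S → S // IsEndo f} := by
  refine card_add_length_le (fun e _ => e.1) ?_ (fun e => isEndo_const e.2)
    (fun f => ∀ x y, f x = f y) (fun _ _ _ => rfl) l hl (by simpa using h)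
  intro e e' h
  exact Subtype.ext (congrFun h (Classical.arbitrary S))

section TwoIdempotents

variable [Finite S] {e f : S}

lemma five_le_of_cube_eq_self (h : 4 < Nat.card S) (he : e * e = e) (hef : e * f = e)
    (hne : e ≠ f) (hex : ∀ x, e * x = e) (hsq : ∀ x : S, x * x = e ∨ x * x = f)
    (hcube : ∀ x : S, x * x * x = x) : 5 ≤ Nat.card {f : S → S // IsEndo f} := by
  classical
  have hsq' : ∀ x, x ≠ e → x * x = f := by
    intro x hx
    refine (hsq x).resolve_left fun h' => hx ?_
    rw [← hcube x, h', hex]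
  have hf1 : ∀ x, x ≠ e → f * x = x := fun x hx => by rw [← hsq' x hx, hcube]
  let T : Subsemigroup S :=
    { carrier := {x | x ≠ e}
      mul_mem' := by
        intro x y hx hy hxy
        apply hx
        rw [← hf1 x hx, mul_comm, ← hsq' y hy, ← mul_assoc, hxy, hex] }
  have hT : Nat.card S ≤ Nat.card T + 1 := by
    have h1 := Set.ncard_add_ncard_compl ({e} : Set S)
    rw [Set.ncard_singleton] at h1
    have h2 : Nat.card T = ({e}ᶜ : Set S).ncard := rfl
    omega
  have h4 := card_le_card_endo_of_inverses (S := T) ⟨f, hne.symm⟩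
    (fun x => Subtype.ext (hf1 x x.2)) (fun x => ⟨x, Subtype.ext (hsq' x x.2)⟩)
  let F : {g : T → T // IsEndo g} → S → S := fun g x => if hx : x = e then e else g.1 ⟨x, hx⟩
  have hF : ∀ g x (hx : x ≠ e), F g x = g.1 ⟨x, hx⟩ := fun g x hx => dif_neg hx
  have hFe : ∀ g, F g e = e := fun g => dif_pos rfl
  have := card_add_length_le F ?_ ?_ (fun g => g f ≠ e) ?_ [fun _ => e] (by simp)
    (by simpa using isEndo_const he)
  · simp only [List.length_singleton] at this
    omega
  · intro g g' hgg
    ext x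
    have := congrFun hgg x
    rwa [hF g x x.2, hF g' x x.2] at this
  · intro g x y
    by_cases hx : x = e
    · subst hx; simp only [hex, hFe]
    by_cases hy : y = e
    · subst hy; rw [mul_comm, mul_comm (F g x)]; simp only [hex, hFe]
    have hxy : x * y ≠ e := T.mul_mem hx hy
    rw [hF g x hx, hF g y hy, hF g _ hxy]
    exact congrArg Subtype.val (g.2 ⟨x, hx⟩ ⟨y, hy⟩)
  · intro g
    rw [hF g f hne.symm]
    exact (g.1 _).2

lemma exists_endo_of_cube_eq_sq (h : 4 < Nat.card S) (he : e * e = e) (hf : f * f = f)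
    (hne : e ≠ f) (hex : ∀ x, e * x = e) (hsq : ∀ x : S, x * x = e ∨ x * x = f)
    (hcube : ∀ x : S, x * x * x = x * x)
    (hf1 : (∀ x, f * x = x) ∨ (∀ x, f * x = x * x)) :
    ∃ g : S → S, IsEndo g ∧ g ≠ (fun x => x) ∧ g ≠ (fun x => x * x) ∧ g e = e ∧ g f = f := by
  classical
  obtain ⟨a, hae, haf, ha⟩ :
      ∃ a, a ≠ e ∧ a ≠ f ∧ IsEndo (Function.update (fun x => x * x) a a) := by
    obtain ⟨c, hc⟩ := exists_ne_ne_of_four_lt_card h e f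
    rcases hf1 with hf1 | hf1
    · have hsq' : ∀ x, x ≠ f → x * x = e := by
        intro x hx
        refine (hsq x).resolve_right fun h' => hx ?_
        rw [← hf1 x, ← h', hcube]
      obtain ⟨a, ⟨hae, haf⟩, ha⟩ := exists_not_multiple {x | x ≠ f} {x | x ≠ e ∧ x ≠ f}
        (by
          intro x hx y hy hxy
          apply hne
          rw [← hf, ← hxy, mul_mul_mul_comm, hsq' x hx, hex]) ⟨c, hc⟩ (by
          rintro x ⟨hx, -⟩ t ht hxt
          apply hx
          rw [hxt, hxt, mul_assoc, hsq' t ht, mul_comm, hex])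
      have ha' : ∀ y z, y ≠ f → z ≠ f → a ≠ y * z := by
        intro y z hy hz hyz
        by_cases hye : y = e
        · exact hae (by rw [hyz, hye, hex])
        · exact ha y ⟨hye, hy⟩ z hz hyz
      refine ⟨a, hae, haf, fun x y => ?_⟩
      have huf : Function.update (fun x => x * x) a a f = f := by
        rw [Function.update_of_ne haf.symm, hf]
      by_cases hx : x = f
      · subst hx; rw [huf, hf1, hf1]
      by_cases hy : y = f
      · subst hy; rw [huf, mul_comm, hf1, mul_comm, hf1]
      rw [Function.update_of_ne (ha' x y hx hy).symm]
      rw [mul_mul_mul_comm, hsq' x hx, hex]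
      by_cases hxa : x = a <;> by_cases hya : y = a
      · simp [hxa, hya, hsq' a haf]
      · simp [hxa, Function.update_of_ne hya, hsq' y hy, mul_comm a, hex]
      · simp [hya, Function.update_of_ne hxa, hsq' x hx, hex]
      · simp [Function.update_of_ne hxa, Function.update_of_ne hya, hsq' x hx, hex]
    · have hP : ∀ x, x ≠ e → x ≠ f → x * x ≠ x := by
        intro x hxe hxf hx
        rcases hsq x with h' | h'
        · exact hxe (hx.symm.trans h')
        · exact hxf (hx.symm.trans h')
      have hsqsq : ∀ x : S, x * x * (x * x) = x * x := by
        intro x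
        rcases hsq x with h' | h' <;> rw [h'] <;> assumption
      obtain ⟨a, ⟨hae, haf⟩, ha⟩ := exists_not_multiple Set.univ {x | x ≠ e ∧ x ≠ f}
        (by simp) ⟨c, hc⟩ (by
          rintro x ⟨hxe, hxf⟩ t - hxt
          have hxt' : x = x * (t * t) := by rw [← mul_assoc, ← hxt, ← hxt]
          rcases hsq t with h' | h' <;> rw [h', mul_comm] at hxt'
          · exact hxe (hxt'.trans (hex x))
          · exact hP x hxe hxf ((hxt'.trans (hf1 x)).symm))
      refine ⟨a, hae, haf, isEndo_sq.update ?_ (hsqsq a).symm ?_⟩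
      · intro y z hyz
        by_cases hye : y = e
        · exact hae (by rw [hyz, hye, hex])
        by_cases hyf : y = f
        · refine hP a hae haf ?_
          rw [hyz, hyf, hf1, hsqsq]
        exact ha y ⟨hye, hyf⟩ z trivial hyz
      · intro y _
        rw [mul_mul_mul_comm a y]
        rcases hsq y with h' | h' <;> rw [h', mul_comm, mul_comm (a * a)]
        · rw [hex, hex]
        · rw [hf1, hf1, hsqsq]
  obtain ⟨b, hbe, hbf, hba⟩ : ∃ b, b ≠ e ∧ b ≠ f ∧ b ≠ a := by
    obtain ⟨b, hb⟩ := exists_notMem_of_card_lt h {e, f, a} Finset.card_le_three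
    exact ⟨b, by simpa using hb⟩
  refine ⟨Function.update (fun x => x * x) a a, ?_, ?_, ?_, ?_, ?_⟩
  · exact ha
  · intro hg
    have := congrFun hg b
    simp only [Function.update_of_ne hba] at this
    rcases hsq b with h' | h'
    · exact hbe (this.symm.trans h')
    · exact hbf (this.symm.trans h')
  · intro hg
    have := congrFun hg a
    simp only [Function.update_self] at this
    rcases hsq a with h' | h'
    · exact hae (this.trans h')
    · exact haf (this.trans h')
  · simp [Function.update_of_ne hae.symm, he]
  · simp [Function.update_of_ne haf.symm, hf]

lemma five_le_of_two_idempotents (h : 4 < Nat.card S) (he : e * e = e) (hf : f * f = f)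
    (hef : e * f = e) (hne : e ≠ f) (hE : ∀ x, x * x = x → x = e ∨ x = f) :
    5 ≤ Nat.card {f : S → S // IsEndo f} := by
  classical
  by_contra hcon
  have : Nonempty S := ⟨e⟩
  obtain ⟨c, hce, hcf⟩ := exists_ne_ne_of_four_lt_card h e f
  have hcard : 2 ≤ Nat.card {x : S // x * x = x} := by
    have := Nat.card_le_card_of_injective
      (fun b : Bool => (if b then ⟨e, he⟩ else ⟨f, hf⟩ : {x : S // x * x = x})) (by
        intro b b' hb
        cases b <;> cases b' <;> simp_all)
    simpa using this
  obtain ⟨N, -, hN⟩ := exists_spow_idempotent S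
  have hid : ∀ x : S, x * x = x → ∀ n, spow x n = x := by
    intro x hx n
    induction n with
    | zero => rfl
    | succ n ih => rw [spow, ih, hx]
  have hω : (fun x : S => spow x N) ≠ fun x => x := by
    intro hh
    have := congrFun hh c
    rcases hE _ (hN c) with h' | h' <;> simp_all
  -- any endomorphism separating `e` and `f` is the identity or the idempotent power map
  have key : ∀ g : S → S, IsEndo g → g e ≠ g f → g = (fun x => x) ∨ g = fun x => spow x N := by
    intro g hg hgef
    by_contra! hh
    have := card_idempotents_add_length_le [fun x => x, fun x : S => spow x N, g]
      (by simp [hω.symm, hh.1.symm, hh.2.symm]) (by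
        simp only [List.mem_cons, List.not_mem_nil, or_false, forall_eq_or_imp, forall_eq]
        exact ⟨⟨fun _ _ => rfl, e, f, hne⟩,
          ⟨isEndo_spow N, e, f, by rwa [hid e he, hid f hf]⟩, hg, e, f, hgef⟩)
    simp only [List.length_cons, List.length_nil] at this
    omega
  have hω_sq : (fun x : S => x * x) = fun x => spow x N := by
    refine (key _ isEndo_sq (by simpa [he, hf] using hne)).resolve_left fun hh => ?_
    rcases hE c (congrFun hh c) with h' | h' <;> contradiction
  have hsq : ∀ x : S, x * x = e ∨ x * x = f := fun x => by
    have : x * x = spow x N := congrFun hω_sq x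
    exact hE _ (by rw [this, hN])
  rw [← hω_sq] at key
  have hex : ∀ x, e * x = e := by
    by_contra! hx
    obtain ⟨x, hx⟩ := hx
    have := card_idempotents_add_length_le
      [fun x => x, fun x : S => x * x, fun x => e * x] (by
        simp only [List.nodup_cons, List.mem_cons, List.not_mem_nil, or_false, not_or,
          not_false_eq_true, List.nodup_nil, and_true]
        refine ⟨⟨?_, ?_⟩, ?_⟩ <;> intro hh
        · rw [← hω_sq] at hω
          exact hω hh.symm
        · exact hne (by simpa [hef] using (congrFun hh f).symm)
        · exact hne (by simpa [hef, hf] using (congrFun hh f).symm)) (by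
        simp only [List.mem_cons, List.not_mem_nil, or_false, forall_eq_or_imp, forall_eq]
        exact ⟨⟨fun _ _ => rfl, e, f, hne⟩,
          ⟨isEndo_sq, e, f, by rwa [he, hf]⟩, isEndo_mul_left he, x, e, by rwa [he]⟩)
    simp only [List.length_cons, List.length_nil] at this
    omega
  rcases key (fun x => spow x 2) (isEndo_spow 2) (by simpa [hid e he, hid f hf] using hne)
    with hc | hc
  · exact hcon (five_le_of_cube_eq_self h he hef hne hex hsq (congrFun hc))
  · obtain ⟨g, hg, hg1, hg2, hge, hgf⟩ := exists_endo_of_cube_eq_sq h he hf hne hex hsq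
      (congrFun hc) (by
        refine (key _ (isEndo_mul_left hf) ?_).imp congrFun congrFun
        rwa [mul_comm, hef, hf])
    exact (key g hg (by rwa [hge, hgf])).elim hg1 hg2

end TwoIdempotents

section UniqueIdempotent

variable [Finite S] {e : S}

/-- The subsemigroup `e * S` of an idempotent `e`. -/
def fixedBy (_he : e * e = e) : Subsemigroup S where
  carrier := {x | e * x = x}
  mul_mem' := by
    intro x y hx hy
    change e * (x * y) = x * y
    rw [← mul_assoc, hx]

lemma card_fixedBy_add_length_le (he : e * e = e) (hinv : ∀ x : S, ∃ y, y * x = e)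
    (l : List (S → S)) (hl : l.Nodup) (h : ∀ f ∈ l, IsEndo f ∧ ∃ x, e * f x ≠ f x) :
    Nat.card (fixedBy he) + l.length ≤ Nat.card {f : S → S // IsEndo f} := by
  have hmem : ∀ x, e * x ∈ fixedBy he := fun x => by
    change e * (e * x) = e * x
    rw [← mul_assoc, he]
  have h1 := card_le_card_endo_of_inverses (S := fixedBy he) ⟨e, he⟩
    (fun x => Subtype.ext x.2) (fun x => by
      obtain ⟨y, hy⟩ := hinv x
      refine ⟨⟨e * y, hmem y⟩, Subtype.ext ?_⟩
      change e * y * x = e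
      rw [mul_assoc, hy, he])
  refine (Nat.add_le_add_right h1 _).trans ?_
  refine card_add_length_le (fun g x => g.1 ⟨e * x, hmem x⟩) ?_ ?_
    (fun g => ∀ x, e * g x = g x) ?_ l hl (by simpa using h)
  · intro g g' hgg
    ext x
    have := congrFun hgg x
    simpa only [show (⟨e * x, hmem x⟩ : fixedBy he) = x from Subtype.ext x.2] using this
  · intro g x y
    simp only
    rw [← MulMemClass.coe_mul, ← g.2]
    exact congrArg (fun z => (g.1 z : S)) (Subtype.ext (isEndo_mul_left he x y))
  · intro g x
    exact (g.1 _).2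

/-- If all non-products are equal, every element outside `e * S` is a power of that element. -/
lemma exists_eq_spow (hirr : ∀ x t : S, x * t = x → e * x = x) {a : S}
    (ha : ∀ b, (∀ x y, b ≠ x * y) → b = a) (x : S) (hx : e * x ≠ x) : ∃ k, x = spow a k := by
  by_contra hk
  obtain ⟨b, ⟨hb, hbk⟩, hb'⟩ := exists_not_multiple Set.univ
    {x : S | e * x ≠ x ∧ ¬ ∃ k, x = spow a k} (by simp) ⟨x, hx, hk⟩
    (fun x hx t _ h => hx.1 (hirr x t h.symm))
  refine hbk ?_
  by_cases hprod : ∀ x y, b ≠ x * y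
  · exact ⟨0, ha b hprod⟩
  push Not at hprod
  obtain ⟨y, z, rfl⟩ := hprod
  have hy : e * y ≠ y := fun h => hb (by rw [← mul_assoc, h])
  have hz : e * z ≠ z := fun h => hb (by rw [mul_left_comm, h])
  obtain ⟨m, hm⟩ : ∃ k, y = spow a k := by
    by_contra h
    exact hb' y ⟨hy, h⟩ z trivial rfl
  obtain ⟨n, hn⟩ : ∃ k, z = spow a k := by
    by_contra h
    exact hb' z ⟨hz, h⟩ y trivial (mul_comm _ _)
  exact ⟨_, by rw [hm, hn, spow_mul_spow]⟩

/-- The power maps contribute endomorphisms not mapping into `e * S`. -/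
lemma card_fixedBy_add_le_of_spow (he : e * e = e) (hinv : ∀ x : S, ∃ y, y * x = e)
    (hirr : ∀ x t : S, x * t = x → e * x = x) {m : ℕ} {x : S} (hx : e * spow x m ≠ spow x m) :
    Nat.card (fixedBy he) + (m + 1) ≤ Nat.card {f : S → S // IsEndo f} := by
  have hlt : ∀ i ≤ m, e * spow x i ≠ spow x i := fun i hi h => hx (mul_spow_of_le hi h)
  have hne : ∀ i ≤ m, ∀ j, i < j → spow x i ≠ spow x j := by
    intro i hi j hij h
    obtain ⟨d, rfl⟩ := Nat.exists_eq_add_of_lt hij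
    exact hlt i hi (hirr _ (spow x d) (by rw [spow_mul_spow, ← h]))
  have := card_fixedBy_add_length_le he hinv ((List.range (m + 1)).map fun k x => spow x k)
    (by
      refine List.Nodup.map_on ?_ List.nodup_range
      intro i hi j hj hij
      rw [List.mem_range] at hi hj
      by_contra hij'
      rcases lt_or_gt_of_ne hij' with h | h
      · exact hne i (by omega) j h (congrFun hij x)
      · exact hne j (by omega) i h (congrFun hij x).symm) (by
      intro f hf
      obtain ⟨k, hk, rfl⟩ := List.mem_map.1 hf
      rw [List.mem_range] at hk
      exact ⟨isEndo_spow k, x, hlt k (by omega)⟩)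
  simpa using this

lemma five_le_of_unique_idempotent (h : 4 < Nat.card S) (he : e * e = e)
    (hE : ∀ x, x * x = x → x = e) : 5 ≤ Nat.card {f : S → S // IsEndo f} := by
  classical
  obtain ⟨N, hN1, hN⟩ := exists_spow_idempotent S
  have hNe : ∀ x, spow x N = e := fun x => hE _ (hN x)
  have hinv : ∀ x : S, ∃ y, y * x = e := by
    intro x
    obtain ⟨M, rfl⟩ := Nat.exists_eq_add_of_le' hN1
    exact ⟨spow x M, hNe x⟩
  have hirr : ∀ x t : S, x * t = x → e * x = x := by
    intro x t hxt
    have : ∀ n, x * spow t n = x := by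
      intro n
      induction n with
      | zero => exact hxt
      | succ n ih => rw [spow, ← mul_assoc, ih, hxt]
    rw [mul_comm, ← hNe t, this]
  by_contra hcon
  set t := Nat.card (fixedBy he) with ht
  have hlist := card_fixedBy_add_length_le he hinv
  have hpow : ∀ x, e * spow x (4 - t) = spow x (4 - t) := by
    intro x
    by_contra hx
    have := card_fixedBy_add_le_of_spow he hinv hirr hx
    omega
  have ht1 : 1 ≤ t := by
    have : Nonempty (fixedBy he) := ⟨⟨e, he⟩⟩
    exact Nat.card_pos
  obtain ⟨c, hc⟩ : ∃ c, e * c ≠ c := by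
    by_contra! hc
    have := hlist [] (by simp) (by simp)
    have : t = Nat.card S :=
      Nat.card_congr (Equiv.subtypeUnivEquiv (p := fun x => x ∈ fixedBy he) hc)
    simp only [List.length_nil] at *
    omega
  have ht3 : t ≤ 3 := by
    by_contra ht3
    have := hpow c
    rw [show 4 - t = 0 by omega] at this
    exact hc this
  -- non-products
  have hA : ∀ a, (∀ x y, a ≠ x * y) → e * a ≠ a := fun a ha h => ha e a h.symm
  obtain ⟨a, ha⟩ : ∃ a : S, ∀ x y, a ≠ x * y := by
    obtain ⟨a, ha, ha'⟩ := exists_not_multiple Set.univ {x : S | e * x ≠ x} (by simp) ⟨c, hc⟩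
      (fun x hx t _ h => hx (hirr x t h.symm))
    refine ⟨a, fun x y hxy => ha' x ?_ y trivial hxy⟩
    intro hx
    exact ha (by rw [hxy, ← mul_assoc, hx])
  obtain ⟨b, hb, hba⟩ : ∃ b : S, (∀ x y, b ≠ x * y) ∧ b ≠ a := by
    by_contra! hb
    have hgen := exists_eq_spow hirr hb
    have hcov : (Set.univ : Set S) ⊆
        (fixedBy he : Set S) ∪ ((Finset.range (4 - t)).image (spow a) : Finset S) := by
      intro x _
      by_cases hx : e * x = x
      · exact Or.inl hx
      obtain ⟨k, rfl⟩ := hgen x hx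
      refine Or.inr ?_
      simp only [Finset.coe_image, Set.mem_image, Finset.coe_range, Set.mem_Iio]
      refine ⟨k, ?_, rfl⟩
      by_contra hk
      exact hx (mul_spow_of_le (by omega) (hpow a))
    have h1 := (Set.ncard_le_ncard hcov).trans (Set.ncard_union_le _ _)
    rw [Set.ncard_univ, Set.ncard_coe_finset] at h1
    have h2 : ((Finset.range (4 - t)).image (spow a)).card ≤ 4 - t := by
      simpa using Finset.card_image_le (s := Finset.range (4 - t)) (f := spow a)
    have h3 : (fixedBy he : Set S).ncard = t := rfl
    omega
  have hea := hA a ha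
  have heb := hA b hb
  -- the endomorphism `x ↦ e * x`, modified to fix the non-product `x`
  have hfix : ∀ x : S, (∀ y z, x ≠ y * z) → e * (x * x) = x * x →
      IsEndo (Function.update (fun y => e * y) x x) := fun x hx hxx =>
    (isEndo_mul_left he).update hx hxx.symm fun y _ => mul_left_comm _ _ _
  have hfix_id : Function.update (fun y => e * y) a a ≠ fun x => x := fun hh =>
    heb (by simpa [Function.update_of_ne hba] using congrFun hh b)
  have hnsq : ∀ x : S, (∀ y z, x ≠ y * z) → x * x ≠ x := fun x hx h => hx x x h.symm
  have ht123 : t = 1 ∨ t = 2 ∨ t = 3 := by omega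
  rcases ht123 with ht' | ht' | ht'
  · have hex : ∀ x, e * x = e := by
      intro x
      have hsub : Subsingleton (fixedBy he) := (Nat.card_eq_one_iff_unique.1 ht').1
      have hmem : e * x ∈ fixedBy he := by
        change e * (e * x) = e * x
        rw [← mul_assoc, he]
      exact congrArg Subtype.val (Subsingleton.elim (⟨e * x, hmem⟩ : fixedBy he) ⟨e, he⟩)
    obtain ⟨z, hze, hzz⟩ : ∃ z, z ≠ e ∧ z * z = e := by
      have hex' : ∃ n, spow a n = e := ⟨N, hNe a⟩
      have hmin : ∀ m < Nat.find hex', spow a m ≠ e := fun m => Nat.find_min hex'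
      have hspec := Nat.find_spec hex'
      set n := Nat.find hex'
      obtain _ | k := n
      · exact absurd (by rw [hex]; exact hspec.symm) hea
      · refine ⟨spow a k, hmin k (Nat.lt_succ_self k), ?_⟩
        have := mul_spow_of_le (e := e) (show k + 1 ≤ k + k + 1 by omega)
          (by rw [hspec, he] : e * spow a (k + 1) = spow a (k + 1))
        rw [spow_mul_spow, ← this, hex]
    have hu1 : ∀ x : S, (∀ y w, x ≠ y * w) → IsEndo (Function.update (fun _ : S => e) x z) :=
      fun x hx => (isEndo_const he).update hx hzz fun y _ => by rw [mul_comm, hex]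
    have hu3 : IsEndo (Function.update (Function.update (fun _ : S => e) a z) b z) := by
      refine (hu1 a ha).update hb ?_ fun y hy => ?_
      · rw [hzz, Function.update_of_ne (ha b b).symm]
      · rw [Function.update_of_ne (ha b y).symm]
        by_cases hya : y = a
        · rw [hya, Function.update_self, hzz]
        · rw [Function.update_of_ne hya, mul_comm, hex]
    have hae : a ≠ e := fun h => ha e e (h.trans he.symm)
    have hbe : b ≠ e := fun h => hb e e (h.trans he.symm)
    have := hlist [fun x => x, Function.update (fun _ => e) a z, Function.update (fun _ => e) b z,
        Function.update (Function.update (fun _ => e) a z) b z] (by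
      simp only [List.nodup_cons, List.mem_cons, List.not_mem_nil, or_false, not_or,
        not_false_eq_true, List.nodup_nil, and_true]
      refine ⟨⟨?_, ?_, ?_⟩, ⟨?_, ?_⟩, ?_⟩ <;> intro hh <;>
        have h1 := congrFun hh a <;> have h2 := congrFun hh b <;>
        simp [hba, hba.symm] at h1 h2
      · exact hbe h2
      · exact hae h1
      · exact hba (h2.trans h1.symm)
      · exact hze h1
      · exact hze h2.symm
      · exact hze h1.symm) (by
      simp only [List.mem_cons, List.not_mem_nil, or_false, forall_eq_or_imp, forall_eq]
      refine ⟨⟨fun _ _ => rfl, a, hea⟩, ⟨hu1 a ha, a, ?_⟩, ⟨hu1 b hb, b, ?_⟩, hu3, b, ?_⟩ <;>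
        simp [hex, hze.symm])
    simp only [List.length_cons, List.length_nil] at this
    omega
  · have hxxe : ∀ x, e * (x * x) = e := by
      intro x
      obtain ⟨u, -, hu⟩ := (Nat.card_eq_two_iff' (⟨e, he⟩ : fixedBy he)).1 ht'
      have hmem : ∀ y, e * y ∈ fixedBy he := fun y => by
        change e * (e * y) = e * y
        rw [← mul_assoc, he]
      by_contra hne
      have h1 := hu ⟨_, hmem (x * x)⟩ fun h => hne (congrArg Subtype.val h)
      have h2 := hu ⟨_, hmem x⟩ fun h => hne (by
        have : e * x = e := congrArg Subtype.val h
        rw [← mul_assoc, this, this])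
      have h3 : e * (x * x) = e * x := congrArg Subtype.val (h1.trans h2.symm)
      exact hne (hE _ (by rw [h3, mul_mul_mul_comm, he, h3]))
    by_cases hallsq : ∀ x, e * (x * x) = x * x
    · have := hlist [fun x => x, Function.update (fun y => e * y) a a,
          Function.update (fun y => e * y) b b] (by
        simp only [List.nodup_cons, List.mem_cons, List.not_mem_nil, or_false, not_or,
          not_false_eq_true, List.nodup_nil, and_true]
        refine ⟨⟨hfix_id.symm, ?_⟩, ?_⟩ <;> intro hh <;> have h1 := congrFun hh a <;>
          simp [hba.symm] at h1
        · exact hea h1.symm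
        · exact hea h1.symm) (by
        simp only [List.mem_cons, List.not_mem_nil, or_false, forall_eq_or_imp, forall_eq]
        exact ⟨⟨fun _ _ => rfl, a, hea⟩, ⟨hfix a ha (hallsq a), a, by simpa using hea⟩,
          hfix b hb (hallsq b), b, by simpa using heb⟩)
      simp only [List.length_cons, List.length_nil] at this
      omega
    · push Not at hallsq
      obtain ⟨x, hx⟩ := hallsq
      obtain ⟨g, hg, hg1, hg2, hg3⟩ : ∃ g : S → S, IsEndo g ∧ g ≠ (fun x => x) ∧
          g ≠ (fun x => x * x) ∧ ∃ x, e * g x ≠ g x := by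
        by_cases hasq : e * (a * a) = a * a
        · refine ⟨_, hfix a ha hasq, hfix_id, fun hh => ?_, a, by simpa using hea⟩
          exact hnsq a ha (by simpa using (congrFun hh a).symm)
        by_cases hbsq : e * (b * b) = b * b
        · refine ⟨_, hfix b hb hbsq, fun hh => ?_, fun hh => ?_, b, by simpa using heb⟩
          · exact hea (by simpa [Function.update_of_ne hba.symm] using congrFun hh a)
          · exact hnsq b hb (by simpa using (congrFun hh b).symm)
        · refine ⟨Function.update (fun _ => e) a (a * a),
            (isEndo_const he).update ha ?_ ?_, ?_, ?_, a, by simpa using hasq⟩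
          · have hcube : e * spow a 2 = spow a 2 := by
              have := hpow a
              rwa [ht'] at this
            have := mul_spow_of_le (show 2 ≤ 1 + 1 + 1 by omega) hcube
            rw [← spow_mul_spow] at this
            exact this.symm.trans (hxxe _)
          · intro y _
            rw [mul_comm, hxxe]
          · intro hh
            exact hnsq a ha (by simpa using congrFun hh a)
          · intro hh
            have hbb : e = b * b := by simpa [Function.update_of_ne hba] using congrFun hh b
            exact hbsq (by rw [← hbb, he])
      have := hlist [fun x => x, fun x => x * x, g] (by
        simp only [List.nodup_cons, List.mem_cons, List.not_mem_nil, or_false, not_or,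
          not_false_eq_true, List.nodup_nil, and_true]
        exact ⟨⟨fun hh => hnsq a ha (congrFun hh a).symm, hg1.symm⟩, hg2.symm⟩) (by
        simp only [List.mem_cons, List.not_mem_nil, or_false, forall_eq_or_imp, forall_eq]
        exact ⟨⟨fun _ _ => rfl, a, hea⟩, ⟨isEndo_sq, x, hx⟩, hg, hg3⟩)
      simp only [List.length_cons, List.length_nil] at this
      omega
  · have hallsq : ∀ x, e * (x * x) = x * x := by
      intro x
      have := hpow x
      rwa [ht'] at this
    have := hlist [fun x => x, Function.update (fun y => e * y) a a]
      (by simpa using hfix_id.symm) (by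
        simp only [List.mem_cons, List.not_mem_nil, or_false, forall_eq_or_imp, forall_eq]
        exact ⟨⟨fun _ _ => rfl, a, hea⟩, hfix a ha (hallsq a), a, by simpa using hea⟩)
    simp only [List.length_cons, List.length_nil] at this
    omega

end UniqueIdempotent

/-- Any finite commutative semigroup with more than four elements has at least five
endomorphisms. -/
lemma five_le_card_endo [Finite S] (h : 4 < Nat.card S) :
    5 ≤ Nat.card {f : S → S // IsEndo f} := by
  classical
  have : Nonempty S := (Nat.card_pos_iff.1 (by omega)).1
  obtain ⟨N, -, hN⟩ := exists_spow_idempotent S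
  have hpos : 1 ≤ Nat.card {x : S // x * x = x} := by
    have : Nonempty {x : S // x * x = x} := ⟨⟨_, hN (Classical.arbitrary S)⟩⟩
    exact Nat.card_pos
  have hid : ∀ x : S, x * x = x → ∀ n, spow x n = x := by
    intro x hx n
    induction n with
    | zero => rfl
    | succ n ih => rw [spow, ih, hx]
  obtain ⟨p, q, hpq⟩ : ∃ p q : S, p ≠ q := by
    have : Nontrivial S := Finite.one_lt_card_iff_nontrivial.1 (by omega)
    exact exists_pair_ne S
  by_cases h4 : 4 ≤ Nat.card {x : S // x * x = x}
  · have := card_idempotents_add_length_le [fun x : S => x] (by simp)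
      (by simpa using ⟨fun _ _ => rfl, p, q, hpq⟩)
    simp only [List.length_cons, List.length_nil] at this
    omega
  obtain ⟨e₀, he₀⟩ : ∃ e : S, e * e = e := ⟨_, hN p⟩
  by_cases h1 : ∀ x : S, x * x = x → x = e₀
  · exact five_le_of_unique_idempotent h he₀ h1
  push Not at h1
  obtain ⟨f₀, hf₀, hne₀⟩ := h1
  by_cases h3 : Nat.card {x : S // x * x = x} = 3
  · obtain ⟨c, hc⟩ : ∃ c : S, c * c ≠ c := by
      by_contra! hc
      have := Nat.card_congr (Equiv.subtypeUnivEquiv hc)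
      omega
    have := card_idempotents_add_length_le [fun x : S => x, fun x => spow x N] (by
        simp only [List.nodup_cons, List.mem_cons, List.not_mem_nil, or_false,
          not_false_eq_true, List.nodup_nil, and_true]
        intro hh
        have := hN c
        rw [← congrFun hh c] at this
        exact hc this) (by
        simp only [List.mem_cons, List.not_mem_nil, or_false, forall_eq_or_imp, forall_eq]
        exact ⟨⟨fun _ _ => rfl, p, q, hpq⟩, isEndo_spow N, f₀, e₀, by
          rwa [hid _ hf₀, hid _ he₀]⟩)
    simp only [List.length_cons, List.length_nil] at this
    omega
  have hE : ∀ x : S, x * x = x → x = e₀ ∨ x = f₀ := by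
    intro x hx
    by_contra! hcon
    have := Nat.card_le_card_of_injective (fun i : Fin 3 =>
      (![⟨x, hx⟩, ⟨e₀, he₀⟩, ⟨f₀, hf₀⟩] i : {x : S // x * x = x})) (by
        intro i j hij
        fin_cases i <;> fin_cases j <;>
          simp_all [hcon.1.symm, hcon.2.symm, hne₀.symm])
    rw [Nat.card_fin] at this
    omega
  rcases hE (e₀ * f₀) (by rw [mul_mul_mul_comm, he₀, hf₀]) with hp | hp
  · exact five_le_of_two_idempotents h he₀ hf₀ hp hne₀.symm hE
  · exact five_le_of_two_idempotents h hf₀ he₀ (by rwa [mul_comm]) hne₀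
      fun x hx => (hE x hx).symm

end

end CommSemigroupEndo

/-- **Borisov.** Every finite commutative semigroup with more than four
elements has at least five endomorphisms. -/
theorem five_le_card_endomorphisms_of_comm {S : Type*} [CommSemigroup S] [Finite S]
    (h : 4 < Nat.card S) :
    5 ≤ Nat.card {f : S → S // ∀ x y : S, f (x * y) = f x * f y} := by
  exact CommSemigroupEndo.five_le_card_endo h
end

section
/- Every finitely generated commutative semigroup without idempotents has finite chain rank: if S is a commutative semigroup without idempotents that is generated by a finite set, then there exists a natural number r such that every chain in S with respect to the order a < b ⟺ (a = ab ∧ a = ba) has at most r elements. -/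
theorem exists_coe_eq_prod_pow_of_closure_eq_top {S : Type*} [CommSemigroup S] {F : Finset S}
    (hF : Subsemigroup.closure (F : Set S) = ⊤) (s : S) :
    ∃ w : F → ℕ, (s : WithOne S) = ∏ f : F, ((f : S) : WithOne S) ^ w f := by
  have hs : s ∈ Subsemigroup.closure (F : Set S) := hF ▸ Subsemigroup.mem_top s
  induction hs using Subsemigroup.closure_induction with
  | mem x hx =>
    classical
    refine ⟨Pi.single ⟨x, hx⟩ 1, ?_⟩
    rw [Finset.prod_eq_single ⟨x, hx⟩] <;> simp +contextual
  | mul x y _ _ hx hy =>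
    obtain ⟨u, hu⟩ := hx
    obtain ⟨v, hv⟩ := hy
    exact ⟨u + v, by simp [hu, hv, pow_add, Finset.prod_mul_distrib]⟩

theorem WithOne.exists_coe_eq_pow_succ {S : Type*} [CommSemigroup S] (a : S) (n : ℕ) :
    ∃ b : S, (b : WithOne S) = (a : WithOne S) ^ (n + 1) := by
  induction n with
  | zero => exact ⟨a, by simp⟩
  | succ n ih =>
    obtain ⟨b, hb⟩ := ih
    exact ⟨b * a, by rw [WithOne.coe_mul, hb, ← pow_succ]⟩

theorem WithOne.mul_coe_pow_ne_of_forall_mul_self_ne {S : Type*} [CommSemigroup S]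
    (hni : ∀ e : S, e * e ≠ e) (a : S) {m : ℕ} (hm : m ≠ 0) :
    (a : WithOne S) * (a : WithOne S) ^ m ≠ a := by
  obtain ⟨n, rfl⟩ := Nat.exists_eq_succ_of_ne_zero hm
  intro h
  obtain ⟨b, hb⟩ := WithOne.exists_coe_eq_pow_succ a n
  refine hni b (WithOne.coe_inj.1 ?_)
  rw [WithOne.coe_mul, hb]
  calc (a : WithOne S) ^ (n + 1) * (a : WithOne S) ^ (n + 1)
      = (a : WithOne S) ^ n * (a * (a : WithOne S) ^ (n + 1)) := by rw [pow_succ, mul_assoc]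
    _ = (a : WithOne S) ^ (n + 1) := by rw [h, pow_succ]

theorem mul_prod_pow_eq_mul_pow_of_absorbs {M ι : Type*} [CommMonoid M] [Fintype ι] (x : ι → M)
    (p : ι → ℕ) (i : ι) (h : ∀ j, j ≠ i → p j ≠ 0 → x i * x j = x i) :
    x i * ∏ j, x j ^ p j = x i * x i ^ p i := by
  classical
  have key : x i * ∏ j ∈ Finset.univ.erase i, x j ^ p j = x i := by
    refine Finset.prod_induction (fun j => x j ^ p j) (fun y => x i * y = x i) ?_ (mul_one _) ?_
    · intro a b ha hb
      rw [← mul_assoc, ha, hb]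
    · intro j hj
      have hji := Finset.ne_of_mem_erase hj
      by_cases hp : p j = 0
      · simp [hp]
      · generalize p j = n
        have := h j hji hp
        induction n with
        | zero => simp
        | succ n ih => rw [pow_succ, ← mul_assoc, ih, this]
  rw [← Finset.mul_prod_erase _ _ (Finset.mem_univ i), mul_left_comm, key, mul_comm]

theorem linearIndependent_exponents_of_chain {S : Type*} [CommSemigroup S]
    (hni : ∀ e : S, e * e ≠ e) {F C : Finset S} (w : C → F → ℕ)
    (hw : ∀ c : C, ((c : S) : WithOne S) = ∏ f : F, ((f : S) : WithOne S) ^ w c f)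
    (hC : ∀ a ∈ C, ∀ b ∈ C, a ≠ b → a = a * b ∨ b = b * a) :
    LinearIndependent ℤ fun c f => (w c f : ℤ) := by
  rw [Fintype.linearIndependent_iff]
  intro g hg
  by_contra! hne
  let r : C → C → Prop := fun a b => (a : S) = a * b
  have : IsTrans C r := ⟨fun a b c hab hbc => by
    calc (a : S) = a * b := hab
      _ = a * (b * c) := congrArg _ hbc
      _ = a * c := by rw [← mul_assoc, ← hab]⟩
  have : Std.Irrefl r := ⟨fun a h => hni a h.symm⟩
  obtain ⟨i, hi, hmin⟩ :=
    (Finite.wellFounded_of_trans_of_irrefl r).has_min {c | g c ≠ 0} hne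
  have habs : ∀ j, j ≠ i → g j ≠ 0 → ((i : S) : WithOne S) * ((j : S) : WithOne S) = (i : S) := by
    intro j hji hj
    rcases hC i i.2 j j.2 fun h => hji (Subtype.ext h.symm) with h | h
    · rw [← WithOne.coe_mul, ← h]
    · exact (hmin j hj h).elim
  have hprod (p : C → ℕ) : ∏ c : C, ((c : S) : WithOne S) ^ p c =
      ∏ f : F, ((f : S) : WithOne S) ^ ∑ c, p c * w c f := by
    simp_rw [← Finset.prod_pow_eq_pow_sum]
    rw [Finset.prod_comm]
    refine Finset.prod_congr rfl fun c _ => ?_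
    rw [hw c, ← Finset.prod_pow]
    simp_rw [← pow_mul, mul_comm]
  have hexp (f : F) : ∑ c, (g c).toNat * w c f = ∑ c, (-g c).toNat * w c f := by
    have h := congrFun hg f
    simp only [Finset.sum_apply, Pi.smul_apply, smul_eq_mul, Pi.zero_apply] at h
    zify
    rw [← sub_eq_zero, ← Finset.sum_sub_distrib, ← h]
    refine Finset.sum_congr rfl fun c _ => ?_
    rw [← sub_mul, Int.toNat_sub_toNat_neg]
  have heq : ((i : S) : WithOne S) * ((i : S) : WithOne S) ^ (g i).toNat =
      ((i : S) : WithOne S) * ((i : S) : WithOne S) ^ (-g i).toNat := by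
    rw [← mul_prod_pow_eq_mul_pow_of_absorbs (fun c : C => ((c : S) : WithOne S))
        (fun c => (g c).toNat) i fun j hji hj => habs j hji (by grind),
      ← mul_prod_pow_eq_mul_pow_of_absorbs (fun c : C => ((c : S) : WithOne S))
        (fun c => (-g c).toNat) i fun j hji hj => habs j hji (by grind),
      hprod, hprod]
    simp_rw [hexp]
  rcases lt_or_gt_of_ne (show g i ≠ 0 from hi) with h | h
  · rw [Int.toNat_of_nonpos h.le, pow_zero, mul_one] at heq
    exact WithOne.mul_coe_pow_ne_of_forall_mul_self_ne hni (i : S) (by omega) heq.symm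
  · rw [Int.toNat_of_nonpos (by omega : -g i ≤ 0), pow_zero, mul_one] at heq
    exact WithOne.mul_coe_pow_ne_of_forall_mul_self_ne hni (i : S) (by omega) heq

/-- **Borisov.** Every finitely generated commutative semigroup without
idempotents has finite chain rank: there is an `r` such that every chain with
respect to the strict order `a < b ↔ a = a*b ∧ a = b*a` has at most `r`
elements. -/
theorem finite_chain_rank_of_fg_comm_no_idempotents
    {S : Type*} [CommSemigroup S]
    (hfg : ∃ F : Finset S, Subsemigroup.closure (F : Set S) = ⊤)
    (hni : ∀ e : S, e * e ≠ e) :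
    ∃ r : ℕ, ∀ C : Finset S,
      (∀ a ∈ C, ∀ b ∈ C, a ≠ b →
        (a = a * b ∧ a = b * a) ∨ (b = b * a ∧ b = a * b)) →
      C.card ≤ r := by
  obtain ⟨F, hF⟩ := hfg
  choose w hw using exists_coe_eq_prod_pow_of_closure_eq_top hF
  refine ⟨F.card, fun C hC => ?_⟩
  have hli := linearIndependent_exponents_of_chain hni (fun c : C => w c) (fun c => hw c)
    fun a ha b hb hab => (hC a ha b hb hab).imp And.left And.left
  simpa using hli.fintype_card_le_finrank
end

section
/- Every finite group is determined by its identical inclusions up to isomorphism within the class of finite groups: if G₁ and G₂ are finite groups that satisfy exactly the same identical inclusions (for every word u and every set of words V, G₁ satisfies u ∈̂ V if and only if G₂ satisfies u ∈̂ V), then G₁ and G₂ are isomorphic. -/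
/-- A semigroup `S` satisfies the identical inclusion `u ∈̂ V` (where `u` is a
word and `V` a set of words in the free semigroup over a countable alphabet) if
for every substitution `σ` of variables by elements of `S`, the value of `u`
equals the value of some `v ∈ V`. -/
def SatisfiesInclusion (S : Type*) [Semigroup S]
    (u : FreeSemigroup ℕ) (V : Set (FreeSemigroup ℕ)) : Prop :=
  ∀ σ : ℕ → S, ∃ v ∈ V, FreeSemigroup.lift σ u = FreeSemigroup.lift σ v

/-- The power `w ^ (n + 1)` of a word `w`. -/
def FreeSemigroup.powSucc {α : Type*} (w : FreeSemigroup α) : ℕ → FreeSemigroup α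
  | 0 => w
  | n + 1 => powSucc w n * w

theorem FreeSemigroup.lift_powSucc {α M : Type*} [Monoid M] (σ : α → M) (w : FreeSemigroup α)
    (n : ℕ) : FreeSemigroup.lift σ (w.powSucc n) = FreeSemigroup.lift σ w ^ (n + 1) := by
  induction n with
  | zero => simp [powSucc]
  | succ n ih => rw [powSucc, map_mul, ih, pow_succ _ (n + 1)]

/-- If `G` satisfies every identical inclusion of `H`, then every substitution into `G` has a
counterpart into `H` that identifies no more words. -/
theorem exists_lift_eq_imp_lift_eq {G H : Type*} [Group G] [Finite G] [Group H] [Finite H]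
    (h : ∀ (u : FreeSemigroup ℕ) (V : Set (FreeSemigroup ℕ)), V.Nonempty →
      SatisfiesInclusion H u V → SatisfiesInclusion G u V) (σ : ℕ → G) :
    ∃ τ : ℕ → H, ∀ a b : FreeSemigroup ℕ, FreeSemigroup.lift τ a = FreeSemigroup.lift τ b →
      FreeSemigroup.lift σ a = FreeSemigroup.lift σ b := by
  obtain ⟨n, hn⟩ : ∃ n, n + 2 = 2 * (Nat.card G * Nat.card H) :=
    ⟨_, Nat.sub_add_cancel (Nat.le_mul_of_pos_right 2 (Nat.mul_pos Nat.card_pos Nat.card_pos))⟩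
  have hG (x : G) : x ^ (n + 2) = 1 := by
    rw [hn, mul_left_comm, pow_mul, pow_card_eq_one', one_pow]
  have hH (x : H) : x ^ (n + 2) = 1 := by
    rw [hn, ← mul_assoc, mul_comm, pow_mul, pow_card_eq_one', one_pow]
  by_cases hV : {w | FreeSemigroup.lift σ w ≠ 1}.Nonempty
  · have hσ : ¬ SatisfiesInclusion G ((FreeSemigroup.of 0).powSucc (n + 1))
        {w | FreeSemigroup.lift σ w ≠ 1} := by
      intro hs
      obtain ⟨v, hv, hv'⟩ := hs σ
      rw [FreeSemigroup.lift_powSucc, hG] at hv'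
      exact hv hv'.symm
    have hτ := mt (h _ _ hV) hσ
    unfold SatisfiesInclusion at hτ
    push Not at hτ
    obtain ⟨τ, hτ⟩ := hτ
    refine ⟨τ, fun a b hab => ?_⟩
    by_contra hne
    refine hτ (a * b.powSucc n) ?_ ?_
    · intro h1
      rw [map_mul, FreeSemigroup.lift_powSucc] at h1
      refine hne (mul_right_cancel (b := FreeSemigroup.lift σ b ^ (n + 1)) ?_)
      rw [h1, ← pow_succ', hG]
    · rw [map_mul, FreeSemigroup.lift_powSucc, FreeSemigroup.lift_powSucc, hab, ← pow_succ', hH,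
        hH]
  · have hσ (w : FreeSemigroup ℕ) : FreeSemigroup.lift σ w = 1 := by
      by_contra hw
      exact hV ⟨w, hw⟩
    exact ⟨1, fun a b _ => by rw [hσ, hσ]⟩

/-- If `G` satisfies every identical inclusion of `H`, then `G` injects into `H` by a map that is
multiplicative as soon as it is surjective. -/
theorem exists_injective_map_mul_of_surjective
    {G H : Type*} [Group G] [Finite G] [Group H] [Finite H]
    (h : ∀ (u : FreeSemigroup ℕ) (V : Set (FreeSemigroup ℕ)), V.Nonempty →
      SatisfiesInclusion H u V → SatisfiesInclusion G u V) :
    ∃ f : G → H, Function.Injective f ∧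
      (Function.Surjective f → ∀ x y, f (x * y) = f x * f y) := by
  obtain ⟨σ, hσ⟩ := exists_surjective_nat G
  obtain ⟨τ, hτ⟩ := exists_lift_eq_imp_lift_eq h σ
  have hs (g : G) : ∃ w, FreeSemigroup.lift σ w = g :=
    (hσ g).imp' FreeSemigroup.of fun n hn => by rw [FreeSemigroup.lift_of, hn]
  choose s hs using hs
  refine ⟨fun g => FreeSemigroup.lift τ (s g), fun x y hxy => ?_, fun hsurj x y => ?_⟩
  · simpa only [hs] using hτ _ _ hxy
  · obtain ⟨z, hz⟩ := hsurj (FreeSemigroup.lift τ (s x) * FreeSemigroup.lift τ (s y))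
    have hxy : z = x * y := by
      simpa only [hs, map_mul] using hτ (s z) (s x * s y) (by rw [map_mul]; exact hz)
    rw [← hxy]
    exact hz

/-- **Mashevitzky.** Every finite group is determined by its identical
inclusions up to isomorphism within the class of finite groups. -/
theorem finite_group_determined_by_identical_inclusions
    {G₁ G₂ : Type*} [Group G₁] [Finite G₁] [Group G₂] [Finite G₂]
    (h : ∀ (u : FreeSemigroup ℕ) (V : Set (FreeSemigroup ℕ)), V.Nonempty →
      (SatisfiesInclusion G₁ u V ↔ SatisfiesInclusion G₂ u V)) :
    Nonempty (G₁ ≃* G₂) := by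
  obtain ⟨f, hf, hmul⟩ := exists_injective_map_mul_of_surjective fun u V hV => (h u V hV).2
  obtain ⟨g, hg, -⟩ := exists_injective_map_mul_of_surjective fun u V hV => (h u V hV).1
  have hbij : Function.Bijective f :=
    hf.bijective_of_nat_card_le (Nat.card_le_card_of_injective g hg)
  exact ⟨{ Equiv.ofBijective f hbij with map_mul' := hmul hbij.2 }⟩
end
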